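/- There exists a positive constant C such that the following holds. Let A be a random subset of Z_N (the integers mod N) in which each element is chosen independently with probability C (log N)^{1/3} N^{-2/3}. Then the probability that every Freiman homomorphism from A to Z_N is affine (i.e., of the form a ↦ ra + s for some r, s ∈ Z_N) tends to 1 as N → ∞. More precisely: there exists C > 0 such that for every δ > 0 there exists N_0 such that for all N ≥ N_0, the probability that every Freiman homomorphism from A to Z_N is affine is at least 1 − δ. -/

import Mathlib

open scoped Classical
open Finset

noncomputable section

/-- The weight of a particular outcome `A` when each element of a finite type `G`
is included independently with probability `p`. -/
def bernWeight {G : Type*} [Fintype G] (p : ℝ) (A : Finset G) : ℝ :=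
  p ^ A.card * (1 - p) ^ (Fintype.card G - A.card)

/-- The probability that a random subset of `G`, with each element chosen independently
with probability `p`, satisfies the event `E`. -/
def randomSubsetProb (G : Type*) [Fintype G] (p : ℝ) (E : Finset G → Prop) : ℝ :=
  ∑ A : Finset G, if E A then bernWeight p A else 0

/-- `φ` is a Freiman homomorphism on `U`. -/
def FreimanHomOn {G H : Type*} [AddCommGroup G] [AddCommGroup H]
    (U : Finset G) (φ : G → H) : Prop :=
  ∀ a ∈ U, ∀ b ∈ U, ∀ c ∈ U, ∀ d ∈ U, a + b = c + d → φ a + φ b = φ c + φ d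

section prob
variable {G : Type*} [Fintype G] {p : ℝ}

lemma bw_nonneg (h0 : 0 ≤ p) (h1 : p ≤ 1) (A : Finset G) : 0 ≤ bernWeight p A := by
  unfold bernWeight
  have : 0 ≤ 1 - p := by linarith
  positivity

lemma bw_eq_prod (A : Finset G) :
    bernWeight p A = ∏ x, if x ∈ A then p else 1 - p := by
  unfold bernWeight
  rw [Finset.prod_ite]
  simp only [Finset.prod_const, Finset.filter_mem_eq_inter, Finset.univ_inter]
  congr 2
  rw [← Finset.card_compl]
  congr 1
  ext x; simp

lemma sum_prod_ite (f g : G → ℝ) :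
    ∑ A : Finset G, ∏ x, (if x ∈ A then f x else g x) = ∏ x, (f x + g x) := by
  rw [Finset.prod_add, Finset.powerset_univ]
  refine Finset.sum_congr rfl fun A _ => ?_
  rw [Finset.prod_ite]
  congr 1
  · simp
  · apply Finset.prod_congr _ fun _ _ => rfl
    ext x; simp

lemma bw_sum : ∑ A : Finset G, bernWeight p A = 1 := by
  simp_rw [bw_eq_prod]
  rw [sum_prod_ite]
  simp

lemma pr_nonneg (h0 : 0 ≤ p) (h1 : p ≤ 1) (E : Finset G → Prop) :
    0 ≤ randomSubsetProb G p E := by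
  unfold randomSubsetProb
  refine Finset.sum_nonneg fun A _ => ?_
  split_ifs
  · exact bw_nonneg h0 h1 A
  · exact le_rfl

lemma pr_mono (h0 : 0 ≤ p) (h1 : p ≤ 1) {E F : Finset G → Prop} (h : ∀ A, E A → F A) :
    randomSubsetProb G p E ≤ randomSubsetProb G p F := by
  unfold randomSubsetProb
  refine Finset.sum_le_sum fun A _ => ?_
  have := bw_nonneg h0 h1 A
  split_ifs with h1 h2 <;> first | exact le_rfl | assumption | exact absurd (h _ h1) h2

lemma pr_compl (E : Finset G → Prop) :
    randomSubsetProb G p E = 1 - randomSubsetProb G p (fun A => ¬ E A) := by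
  unfold randomSubsetProb
  rw [eq_sub_iff_add_eq, ← Finset.sum_add_distrib, ← bw_sum (G := G) (p := p)]
  refine Finset.sum_congr rfl fun A _ => ?_
  by_cases h : E A <;> simp [h]

lemma pr_le_one (h0 : 0 ≤ p) (h1 : p ≤ 1) (E : Finset G → Prop) :
    randomSubsetProb G p E ≤ 1 := by
  rw [pr_compl]
  linarith [pr_nonneg h0 h1 (fun A => ¬ E A)]

lemma pr_or (h0 : 0 ≤ p) (h1 : p ≤ 1) (E F : Finset G → Prop) :
    randomSubsetProb G p (fun A => E A ∨ F A)
      ≤ randomSubsetProb G p E + randomSubsetProb G p F := by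
  unfold randomSubsetProb
  rw [← Finset.sum_add_distrib]
  refine Finset.sum_le_sum fun A _ => ?_
  have := bw_nonneg h0 h1 A
  by_cases h1 : E A <;> by_cases h2 : F A <;> simp [h1, h2, this]

lemma pr_exists (h0 : 0 ≤ p) (h1 : p ≤ 1) {ι : Type*} (s : Finset ι) (E : ι → Finset G → Prop) :
    randomSubsetProb G p (fun A => ∃ i ∈ s, E i A)
      ≤ ∑ i ∈ s, randomSubsetProb G p (E i) := by
  unfold randomSubsetProb
  rw [Finset.sum_comm]
  refine Finset.sum_le_sum fun A _ => ?_
  have hw := bw_nonneg h0 h1 A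
  have hnn : ∀ i ∈ s, 0 ≤ (if E i A then bernWeight p A else 0) := by
    intro i _; split_ifs <;> simp [hw]
  split_ifs with h
  · obtain ⟨i, hi, hE⟩ := h
    calc bernWeight p A = if E i A then bernWeight p A else 0 := by simp [hE]
      _ ≤ _ := Finset.single_le_sum hnn hi
  · exact Finset.sum_nonneg hnn

/-- Expectation of a product over the random set. -/
lemma ex_prod (h : G → ℝ) :
    ∑ A : Finset G, bernWeight p A * ∏ x ∈ A, h x = ∏ x, (p * h x + (1 - p)) := by
  rw [← sum_prod_ite]
  refine Finset.sum_congr rfl fun A _ => ?_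
  rw [bw_eq_prod, ← Finset.prod_ite_mem_eq A h, ← Finset.prod_mul_distrib]
  refine Finset.prod_congr rfl fun x _ => ?_
  split_ifs <;> ring

lemma pr_avoid (h0 : 0 ≤ p) (h1 : p ≤ 1) (T : Finset G) :
    randomSubsetProb G p (fun A => Disjoint A T) ≤ Real.exp (-(p * T.card)) := by
  have h := ex_prod (p := p) (fun x : G => if x ∈ T then (0 : ℝ) else 1)
  have : randomSubsetProb G p (fun A => Disjoint A T)
      = ∑ A : Finset G, bernWeight p A * ∏ x ∈ A, (if x ∈ T then (0 : ℝ) else 1) := by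
    unfold randomSubsetProb
    refine Finset.sum_congr rfl fun A _ => ?_
    split_ifs with hd
    · rw [Finset.prod_congr rfl (g := fun _ => (1 : ℝ))]
      · simp
      · intro x hx
        rw [if_neg (Finset.disjoint_left.1 hd hx)]
    · rw [Finset.not_disjoint_iff] at hd
      obtain ⟨x, hx, hxT⟩ := hd
      rw [Finset.prod_eq_zero hx (by simp [hxT]), mul_zero]
  rw [this, h]
  have h2 : ∏ x : G, (p * (if x ∈ T then (0 : ℝ) else 1) + (1 - p)) = (1 - p) ^ T.card := by
    rw [← Finset.prod_const, ← Finset.prod_ite_mem_eq T (fun _ => 1 - p)]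
    refine Finset.prod_congr rfl fun x _ => ?_
    split_ifs <;> ring
  rw [h2]
  calc (1 - p) ^ T.card ≤ (Real.exp (-p)) ^ T.card := by
        have h3 := Real.add_one_le_exp (-p)
        have h4 : 0 ≤ 1 - p := by linarith
        exact pow_le_pow_left₀ h4 (by linarith) _
    _ = _ := by rw [← Real.exp_nat_mul]; congr 1; ring

lemma pr_tail (h0 : 0 ≤ p) (h1 : p ≤ 1) (Z : Finset G) (t : ℝ) :
    randomSubsetProb G p (fun A => t ≤ ((A ∩ Z).card : ℝ)) ≤ Real.exp (2 * p * Z.card - t) := by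
  have h := ex_prod (p := p) (fun x : G => if x ∈ Z then Real.exp 1 else 1)
  have key : randomSubsetProb G p (fun A => t ≤ ((A ∩ Z).card : ℝ)) ≤
      Real.exp (-t) * ∑ A : Finset G, bernWeight p A * ∏ x ∈ A, (if x ∈ Z then Real.exp 1 else 1) := by
    unfold randomSubsetProb
    rw [Finset.mul_sum]
    refine Finset.sum_le_sum fun A _ => ?_
    have hw := bw_nonneg h0 h1 A
    have hp : ∏ x ∈ A, (if x ∈ Z then Real.exp 1 else 1) = Real.exp ((A ∩ Z).card) := by
      rw [Finset.prod_ite]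
      simp only [Finset.prod_const, Finset.filter_mem_eq_inter, one_pow, mul_one]
      rw [← Real.exp_nat_mul, mul_one]
    rw [hp]
    split_ifs with ht
    · calc bernWeight p A = bernWeight p A * 1 := by ring
        _ ≤ bernWeight p A * Real.exp ((A ∩ Z).card - t) := by
          gcongr
          rw [← Real.exp_zero]
          exact Real.exp_le_exp.2 (by linarith)
        _ = _ := by rw [sub_eq_add_neg, Real.exp_add]; ring
    · positivity
  refine key.trans ?_
  rw [h]
  have h2 : ∏ x : G, (p * (if x ∈ Z then Real.exp 1 else 1) + (1 - p))
      = (1 + p * (Real.exp 1 - 1)) ^ Z.card := by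
    rw [← Finset.prod_const, ← Finset.prod_ite_mem_eq Z (fun _ => 1 + p * (Real.exp 1 - 1))]
    refine Finset.prod_congr rfl fun x _ => ?_
    split_ifs <;> ring
  rw [h2]
  have he : Real.exp 1 ≤ 3 := by linarith [Real.exp_one_lt_d9]
  have he' : 1 ≤ Real.exp 1 := by linarith [Real.exp_one_gt_d9]
  calc Real.exp (-t) * (1 + p * (Real.exp 1 - 1)) ^ Z.card
      ≤ Real.exp (-t) * (Real.exp (2 * p)) ^ Z.card := by
        have : 0 ≤ p * (Real.exp 1 - 1) := mul_nonneg h0 (by linarith)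
        gcongr
        have := Real.add_one_le_exp (2 * p)
        nlinarith
    _ = _ := by rw [← Real.exp_nat_mul, ← Real.exp_add]; congr 1; ring

/-- Splitting a random set into the union of two independent random sets. -/
lemma pr_split {p₁ p₂ : ℝ} (hp : 1 - p = (1 - p₁) * (1 - p₂)) (E : Finset G → Prop) :
    randomSubsetProb G p E =
      ∑ A₁ : Finset G, bernWeight p₁ A₁ * randomSubsetProb G p₂ (fun A₂ => E (A₁ ∪ A₂)) := by
  have hS : ∀ S : Finset G, ∑ A₁ : Finset G, ∑ A₂ : Finset G,
      (if A₁ ∪ A₂ = S then bernWeight p₁ A₁ * bernWeight p₂ A₂ else 0) = bernWeight p S := by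
    intro S
    have h1 : ∀ A₁ : Finset G, ∑ A₂ : Finset G,
      (if A₁ ∪ A₂ = S then bernWeight p₁ A₁ * bernWeight p₂ A₂ else 0) =
        ∏ x, (if x ∈ A₁ then (if x ∈ S then p₁ else 0)
          else (if x ∈ S then (1 - p₁) * p₂ else (1 - p₁) * (1 - p₂))) := by
      intro A₁
      have : ∀ A₂ : Finset G,
          (if A₁ ∪ A₂ = S then bernWeight p₁ A₁ * bernWeight p₂ A₂ else 0) =
          ∏ x, (if x ∈ A₂ then
              (if x ∈ S then (if x ∈ A₁ then p₁ else 1 - p₁) * p₂ else 0)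
            else (if (x ∈ S ↔ x ∈ A₁) then (if x ∈ A₁ then p₁ else 1 - p₁) * (1 - p₂) else 0)) := by
        intro A₂
        split_ifs with hu
        · rw [bw_eq_prod, bw_eq_prod, ← Finset.prod_mul_distrib]
          refine Finset.prod_congr rfl fun x _ => ?_
          have : x ∈ S ↔ x ∈ A₁ ∨ x ∈ A₂ := by rw [← hu]; simp
          by_cases h1 : x ∈ A₁ <;> by_cases h2 : x ∈ A₂ <;> simp [h1, h2, this]
        · symm
          have : ∃ x, ¬ (x ∈ A₁ ∪ A₂ ↔ x ∈ S) := by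
            by_contra hcon
            push Not at hcon
            exact hu (Finset.ext hcon)
          obtain ⟨x, hx⟩ := this
          apply Finset.prod_eq_zero (Finset.mem_univ x)
          rw [Finset.mem_union] at hx
          by_cases h1 : x ∈ A₁ <;> by_cases h2 : x ∈ A₂ <;> by_cases h3 : x ∈ S <;>
            simp_all
      simp_rw [this]
      rw [sum_prod_ite]
      refine Finset.prod_congr rfl fun x _ => ?_
      by_cases h1 : x ∈ A₁ <;> by_cases h3 : x ∈ S <;> simp [h1, h3] <;> ring
    simp_rw [h1]
    rw [sum_prod_ite, bw_eq_prod]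
    refine Finset.prod_congr rfl fun x _ => ?_
    split_ifs
    · linarith
    · linarith
  have : randomSubsetProb G p E = ∑ S : Finset G, if E S then
      ∑ A₁ : Finset G, ∑ A₂ : Finset G,
      (if A₁ ∪ A₂ = S then bernWeight p₁ A₁ * bernWeight p₂ A₂ else 0) else 0 := by
    unfold randomSubsetProb
    simp_rw [hS]
  rw [this]
  have h3 : ∀ S : Finset G, (if E S then
      ∑ A₁ : Finset G, ∑ A₂ : Finset G,
      (if A₁ ∪ A₂ = S then bernWeight p₁ A₁ * bernWeight p₂ A₂ else 0) else 0) =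
      ∑ A₁ : Finset G, ∑ A₂ : Finset G, (if A₁ ∪ A₂ = S then
        (if E (A₁ ∪ A₂) then bernWeight p₁ A₁ * bernWeight p₂ A₂ else 0) else 0) := by
    intro S
    by_cases h : E S
    · rw [if_pos h]
      refine Finset.sum_congr rfl fun A₁ _ => Finset.sum_congr rfl fun A₂ _ => ?_
      split_ifs with h1 h2
      · rfl
      · rw [h1] at h2; exact absurd h h2
      · rfl
    · rw [if_neg h]
      symm
      refine Finset.sum_eq_zero fun A₁ _ => Finset.sum_eq_zero fun A₂ _ => ?_
      split_ifs with h1 h2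
      · rw [h1] at h2; exact absurd h2 h
      · rfl
      · rfl
  simp_rw [h3]
  rw [Finset.sum_comm]
  refine Finset.sum_congr rfl fun A₁ _ => ?_
  rw [Finset.sum_comm]
  unfold randomSubsetProb
  rw [Finset.mul_sum]
  refine Finset.sum_congr rfl fun A₂ _ => ?_
  rw [Finset.sum_ite_eq]
  simp

lemma pr_split_bound {p₁ p₂ α β : ℝ} (hp : 1 - p = (1 - p₁) * (1 - p₂))
    (h10 : 0 ≤ p₁) (h11 : p₁ ≤ 1) (h20 : 0 ≤ p₂) (h21 : p₂ ≤ 1)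
    (E : Finset G → Prop) (F : Finset G → Prop)
    (hF : randomSubsetProb G p₁ F ≤ α) (hβ : 0 ≤ β)
    (hE : ∀ A₁, ¬ F A₁ → randomSubsetProb G p₂ (fun A₂ => E (A₁ ∪ A₂)) ≤ β) :
    randomSubsetProb G p E ≤ α + β := by
  rw [pr_split hp]
  calc ∑ A₁ : Finset G, bernWeight p₁ A₁ * randomSubsetProb G p₂ (fun A₂ => E (A₁ ∪ A₂))
      ≤ ∑ A₁ : Finset G, ((if F A₁ then bernWeight p₁ A₁ else 0) + bernWeight p₁ A₁ * β) := by
        refine Finset.sum_le_sum fun A₁ _ => ?_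
        have hw := bw_nonneg h10 h11 A₁
        split_ifs with h
        · have := pr_le_one h20 h21 (fun A₂ => E (A₁ ∪ A₂))
          nlinarith [mul_nonneg hw hβ]
        · have := hE A₁ h
          nlinarith
    _ = randomSubsetProb G p₁ F + β := by
        rw [Finset.sum_add_distrib, ← Finset.sum_mul, bw_sum, one_mul]; rfl
    _ ≤ _ := by linarith

/-- Single element version of the compression identity. -/
lemma ex_single (x : G) (g : Finset G → ℝ) :
    ∑ A : Finset G, bernWeight p A * (if x ∈ A then g (A.erase x) else 0) =
      p * ∑ A : Finset G, bernWeight p A * g (A.erase x) := by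
  have hu : (Finset.univ : Finset (Finset G)) = (insert x (Finset.univ.erase x)).powerset := by
    rw [Finset.insert_erase (Finset.mem_univ x), Finset.powerset_univ]
  rw [hu, Finset.sum_powerset_insert (Finset.notMem_erase _ _),
    Finset.sum_powerset_insert (Finset.notMem_erase _ _), ← Finset.sum_add_distrib,
    ← Finset.sum_add_distrib, Finset.mul_sum]
  refine Finset.sum_congr rfl fun A hA => ?_
  have hx : x ∉ A := fun h => by
    have := Finset.mem_powerset.1 hA h
    simp at this
  have e1 : bernWeight p A = (1 - p) * ∏ y ∈ Finset.univ.erase x, if y ∈ A then p else 1 - p := by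
    rw [bw_eq_prod, ← Finset.mul_prod_erase _ _ (Finset.mem_univ x), if_neg hx]
  have e2 : bernWeight p (insert x A)
      = p * ∏ y ∈ Finset.univ.erase x, if y ∈ A then p else 1 - p := by
    rw [bw_eq_prod, ← Finset.mul_prod_erase _ _ (Finset.mem_univ x),
      if_pos (Finset.mem_insert_self _ _)]
    congr 1
    refine Finset.prod_congr rfl fun y hy => ?_
    have : y ≠ x := Finset.ne_of_mem_erase hy
    simp [this]
  rw [e1, e2, if_neg hx, if_pos (Finset.mem_insert_self _ _), Finset.erase_insert hx,
    Finset.erase_eq_of_notMem hx]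
  ring

lemma ex_set (K : Finset G) : ∀ (g : Finset G → ℝ),
    ∑ A : Finset G, bernWeight p A * (if K ⊆ A then g (A \ K) else 0) =
      p ^ K.card * ∑ A : Finset G, bernWeight p A * g (A \ K) := by
  induction K using Finset.induction_on with
  | empty => intro g; simp
  | insert x K hx ih =>
    intro g
    have h1 := ex_single (p := p) x (fun B => if K ⊆ B then g (B \ K) else 0)
    have h2 := ih (fun B => g (B.erase x))
    rw [Finset.card_insert_of_notMem hx]
    have e1 : ∀ A : Finset G, (if insert x K ⊆ A then g (A \ insert x K) else 0) =
        (if x ∈ A then (if K ⊆ A.erase x then g (A.erase x \ K) else 0) else 0) := by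
      intro A
      have : A.erase x \ K = A \ insert x K := by
        ext y; simp; tauto
      rw [this]
      by_cases h1 : x ∈ A <;> by_cases h2 : K ⊆ A <;>
        simp [h1, h2, hx, Finset.insert_subset_iff, Finset.subset_erase]
    have e2 : ∀ A : Finset G, (if K ⊆ A then g ((A \ K).erase x) else 0) =
        (if K ⊆ A.erase x then g (A.erase x \ K) else 0) := by
      intro A
      have : A.erase x \ K = (A \ K).erase x := by
        ext y; simp; tauto
      rw [this]
      by_cases h2 : K ⊆ A <;> simp [h2, hx, Finset.subset_erase]
    have e3 : ∀ A : Finset G, (A \ K).erase x = A \ insert x K := by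
      intro A; ext y; simp; tauto
    simp_rw [e1]
    rw [h1]
    simp_rw [← e2]
    rw [h2]
    simp_rw [e3]
    ring

/-- Compression (union bound over sub-configurations of the random set). -/
lemma pr_compress (h0 : 0 ≤ p) (h1 : p ≤ 1) (s : Finset (Finset G))
    (Q : Finset G → Finset G → Prop) :
    randomSubsetProb G p (fun A => ∃ K ∈ s, K ⊆ A ∧ Q K (A \ K)) ≤
      ∑ K ∈ s, p ^ K.card * randomSubsetProb G p (fun A => Q K (A \ K)) := by
  refine (pr_exists h0 h1 s (fun K A => K ⊆ A ∧ Q K (A \ K))).trans ?_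
  refine Finset.sum_le_sum fun K _ => le_of_eq ?_
  have := ex_set (p := p) K (fun B => if Q K B then 1 else 0)
  unfold randomSubsetProb
  refine Eq.trans (Finset.sum_congr rfl fun A _ => ?_)
    (this.trans (congrArg _ (Finset.sum_congr rfl fun A _ => ?_)))
  · by_cases h1 : K ⊆ A <;> by_cases h2 : Q K (A \ K) <;> simp [h1, h2]
  · by_cases h2 : Q K (A \ K) <;> simp [h2]

lemma sum_pow_card (a : ℝ) : ∑ K : Finset G, a ^ K.card = (1 + a) ^ Fintype.card G := by
  have := Finset.prod_one_add (f := fun _ : G => a) Finset.univ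
  simp only [Finset.prod_const, Finset.powerset_univ, Finset.card_univ] at this
  exact this.symm

lemma sum_small (h0 : 0 ≤ p) (L k : ℝ) (hL : 0 ≤ L) (s : Finset (Finset G))
    (hs : ∀ K ∈ s, (K.card : ℝ) ≤ k) :
    ∑ K ∈ s, p ^ K.card ≤ Real.exp (L * k + Real.exp (-L) * (p * Fintype.card G)) := by
  calc ∑ K ∈ s, p ^ K.card ≤ ∑ K ∈ s, Real.exp (L * k) * (Real.exp (-L) * p) ^ K.card := by
        refine Finset.sum_le_sum fun K hK => ?_
        rw [mul_pow, ← Real.exp_nat_mul, ← mul_assoc, ← Real.exp_add]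
        have : 0 ≤ p ^ K.card := pow_nonneg h0 _
        refine le_mul_of_one_le_left this ?_
        rw [← Real.exp_zero]
        apply Real.exp_le_exp.2
        nlinarith [hs K hK]
    _ ≤ ∑ K : Finset G, Real.exp (L * k) * (Real.exp (-L) * p) ^ K.card := by
        apply Finset.sum_le_sum_of_subset_of_nonneg (Finset.subset_univ _)
        intros; positivity
    _ = Real.exp (L * k) * (1 + Real.exp (-L) * p) ^ Fintype.card G := by
        rw [← Finset.mul_sum, sum_pow_card]
    _ ≤ Real.exp (L * k) * (Real.exp (Real.exp (-L) * p)) ^ Fintype.card G := by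
        gcongr
        have := Real.add_one_le_exp (Real.exp (-L) * p)
        linarith
    _ = _ := by rw [← Real.exp_nat_mul, ← Real.exp_add]; congr 1; ring

end prob

lemma growth (ε : ℝ) (hε : 0 < ε) (hε1 : ε ≤ 1) : ∃ κ : ℝ, 0 < κ ∧ κ ≤ ε / 64 ∧
    ∀ (G Ω : Type) [Fintype G] [Fintype Ω] (p : ℝ), 0 ≤ p → p ≤ 1 →
    ∀ (R : G → Finset Ω) (r m M : ℝ), 0 < r → 0 ≤ m →
    (∀ x, ((R x).card : ℝ) ≤ r) →
    (∀ ω, ((Finset.univ.filter (fun x => ω ∈ R x)).card : ℝ) ≤ m) →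
    ε * Fintype.card G * r ≤ ∑ x, ((R x).card : ℝ) →
    m * M ≤ ε * Fintype.card G * r / 2 →
    M ≤ κ * (p * Fintype.card G) * r →
    randomSubsetProb G p (fun B => ((B.biUnion R).card : ℝ) < M) ≤
      Real.exp (-(κ * (p * Fintype.card G))) := by
  set L := Real.log (16 / ε) with hLdef
  have h16 : 1 ≤ 16 / ε := by rw [le_div_iff₀ hε]; linarith
  have hL : 0 ≤ L := Real.log_nonneg h16
  have heL : Real.exp (-L) = ε / 16 := by
    rw [Real.exp_neg, Real.exp_log (by positivity)]; field_simp
  refine ⟨ε ^ 2 / (64 * (L + 1)), by positivity, ?_, ?_⟩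
  · rw [div_le_div_iff₀ (by positivity) (by positivity)]
    nlinarith [mul_nonneg hε.le hL, mul_nonneg (mul_nonneg hε.le hε.le) hL]
  intro G Ω _ _ p h0 h1 R r m M hr hm hR hω hsum hM1 hM2
  set κ := ε ^ 2 / (64 * (L + 1)) with hκ
  have hκ0 : 0 < κ := by positivity
  have hκL : κ * (L + 1) = ε ^ 2 / 64 := by rw [hκ]; field_simp
  set N : ℝ := (Fintype.card G : ℝ) with hN
  have hN0 : 0 ≤ N := by positivity
  set k : ℝ := 4 * κ * (p * N) / ε with hk
  set T : Finset G → Finset G := fun K =>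
    Finset.univ.filter (fun x => ε * r / 4 ≤ ((R x \ K.biUnion R).card : ℝ)) with hT
  set s : Finset (Finset G) := Finset.univ.filter
    (fun K => (K.card : ℝ) ≤ k ∧ ((K.biUnion R).card : ℝ) < M) with hs
  have step1 : randomSubsetProb G p (fun B => ((B.biUnion R).card : ℝ) < M) ≤
      randomSubsetProb G p (fun B => ∃ K ∈ s, K ⊆ B ∧ Disjoint (B \ K) (T K)) := by
    refine pr_mono h0 h1 ?_
    intro B hB
    obtain ⟨K, hK, hmax⟩ := Finset.exists_max_image
      (B.powerset.filter (fun K => (K.card : ℝ) * (ε * r / 4) ≤ ((K.biUnion R).card : ℝ)))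
      (fun K => K.card) ⟨∅, by simp⟩
    rw [Finset.mem_filter, Finset.mem_powerset] at hK
    have hKM : ((K.biUnion R).card : ℝ) < M := by
      refine lt_of_le_of_lt ?_ hB
      exact_mod_cast Finset.card_le_card (Finset.biUnion_subset_biUnion_of_subset_left _ hK.1)
    refine ⟨K, ?_, hK.1, ?_⟩
    · rw [hs, Finset.mem_filter]
      refine ⟨Finset.mem_univ _, ?_, hKM⟩
      rw [hk, le_div_iff₀ hε]
      have : (K.card : ℝ) * (ε * r / 4) ≤ κ * (p * N) * r := by linarith [hK.2]
      have h3 : (K.card * ε) * r ≤ (4 * κ * (p * N)) * r := by linarith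
      exact le_of_mul_le_mul_right h3 hr
    · rw [Finset.disjoint_left]
      intro x hx hxT
      rw [Finset.mem_sdiff] at hx
      rw [hT, Finset.mem_filter] at hxT
      have := hmax (insert x K) (by
        rw [Finset.mem_filter, Finset.mem_powerset]
        refine ⟨Finset.insert_subset hx.1 hK.1, ?_⟩
        rw [Finset.card_insert_of_notMem hx.2, Finset.biUnion_insert]
        have e : (R x ∪ K.biUnion R).card = (R x \ K.biUnion R).card + (K.biUnion R).card := by
          rw [← Finset.card_sdiff_add_card]
        rw [e]; push_cast; linarith [hxT.2, hK.2])
      rw [Finset.card_insert_of_notMem hx.2] at this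
      omega
  have hTcard : ∀ K ∈ s, ε * N / 4 ≤ ((T K).card : ℝ) := by
    intro K hK
    rw [hs, Finset.mem_filter] at hK
    set U := K.biUnion R with hU
    have hdc : ∑ x, ((R x ∩ U).card : ℝ) ≤ m * U.card := by
      have : ∑ x, ((R x ∩ U).card : ℝ)
          = ∑ ω ∈ U, ((Finset.univ.filter (fun x => ω ∈ R x)).card : ℝ) := by
        simp_rw [Finset.card_eq_sum_ones, Finset.sum_filter]
        push_cast
        rw [Finset.sum_comm]
        refine Finset.sum_congr rfl fun x _ => ?_
        rw [Finset.inter_comm, ← Finset.filter_mem_eq_inter, Finset.sum_filter]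
      rw [this]
      calc _ ≤ ∑ ω ∈ U, m := Finset.sum_le_sum fun ω _ => hω ω
        _ = _ := by rw [Finset.sum_const, nsmul_eq_mul, mul_comm]
    have hmU : m * U.card ≤ ε * N * r / 2 := by
      refine le_trans ?_ hM1
      exact mul_le_mul_of_nonneg_left hK.2.2.le hm
    have hsd : ∑ x, ((R x \ U).card : ℝ) ≥ ε * N * r / 2 := by
      have : ∑ x, ((R x).card : ℝ) = ∑ x, ((R x \ U).card : ℝ) + ∑ x, ((R x ∩ U).card : ℝ) := by
        rw [← Finset.sum_add_distrib]
        refine Finset.sum_congr rfl fun x _ => ?_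
        exact_mod_cast (Finset.card_sdiff_add_card_inter (R x) U).symm
      linarith
    have hub : ∑ x, ((R x \ U).card : ℝ) ≤ (T K).card * r + N * (ε * r / 4) := by
      have : ∀ x, ((R x \ U).card : ℝ) ≤ (if x ∈ T K then r else 0) + ε * r / 4 := by
        intro x
        split_ifs with hx
        · have h1 : ((R x \ U).card : ℝ) ≤ (R x).card := by
            exact_mod_cast Finset.card_le_card Finset.sdiff_subset
          have : 0 ≤ ε * r / 4 := by positivity
          linarith [hR x]
        · rw [hT, Finset.mem_filter] at hx
          simp only [Finset.mem_univ, true_and, not_le] at hx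
          linarith
      calc _ ≤ ∑ x, ((if x ∈ T K then r else 0) + ε * r / 4) := Finset.sum_le_sum fun x _ => this x
        _ = _ := by
          rw [Finset.sum_add_distrib, Finset.sum_ite_mem, Finset.univ_inter]
          simp [hN]
    have : (ε * N / 4) * r ≤ (T K).card * r := by linarith
    exact le_of_mul_le_mul_right this hr
  refine step1.trans ((pr_compress h0 h1 s (fun K B => Disjoint B (T K))).trans ?_)
  have hk0 : 0 ≤ k := by positivity
  calc ∑ K ∈ s, p ^ K.card * randomSubsetProb G p (fun A => Disjoint (A \ K) (T K))
      ≤ ∑ K ∈ s, p ^ K.card * Real.exp (-(p * (ε * N / 4)) + k) := by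
        refine Finset.sum_le_sum fun K hK => ?_
        refine mul_le_mul_of_nonneg_left ?_ (pow_nonneg h0 _)
        have e : randomSubsetProb G p (fun A => Disjoint (A \ K) (T K)) ≤
            randomSubsetProb G p (fun A => Disjoint A (T K \ K)) := by
          refine pr_mono h0 h1 fun A hA => ?_
          rw [Finset.disjoint_left] at hA ⊢
          intro x hx hx2
          rw [Finset.mem_sdiff] at hx2
          exact hA (Finset.mem_sdiff.2 ⟨hx, hx2.2⟩) hx2.1
        refine e.trans ((pr_avoid h0 h1 _).trans ?_)
        apply Real.exp_le_exp.2
        have h2 : ((T K).card : ℝ) - K.card ≤ ((T K \ K).card : ℝ) := by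
          have := Finset.le_card_sdiff K (T K)
          have h3 : (T K).card ≤ (T K \ K).card + K.card := by omega
          have : ((T K).card : ℝ) ≤ (T K \ K).card + K.card := by exact_mod_cast h3
          linarith
        have h3 := hTcard K hK
        have h4 : (K.card : ℝ) ≤ k := by
          rw [hs, Finset.mem_filter] at hK; exact hK.2.1
        have h5 : p * (ε * N / 4 - k) ≤ p * (T K \ K).card :=
          mul_le_mul_of_nonneg_left (by linarith) h0
        have h6 : p * k ≤ k := by nlinarith
        linarith
    _ = (∑ K ∈ s, p ^ K.card) * Real.exp (-(p * (ε * N / 4)) + k) := by rw [Finset.sum_mul]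
    _ ≤ Real.exp (L * k + Real.exp (-L) * (p * N)) * Real.exp (-(p * (ε * N / 4)) + k) := by
        gcongr
        apply sum_small h0 L k hL s
        intro K hK
        rw [hs, Finset.mem_filter] at hK; exact hK.2.1
    _ ≤ _ := by
        rw [← Real.exp_add, heL]
        apply Real.exp_le_exp.2
        have hpn : 0 ≤ p * N := by positivity
        have h7 : k * (L + 1) = ε / 16 * (p * N) := by
          rw [hk]
          calc 4 * κ * (p * N) / ε * (L + 1) = 4 * (κ * (L + 1)) * (p * N) / ε := by ring
            _ = _ := by rw [hκL]; field_simp; ring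
        have h8 : κ ≤ ε / 64 := by
          have : κ * 1 ≤ κ * (L + 1) := by gcongr; linarith
          nlinarith
        have h9 : κ * (p * N) ≤ ε / 64 * (p * N) := by gcongr
        have h10 : 0 ≤ ε * (p * N) := by positivity
        nlinarith

section blr
variable {G H : Type} [AddCommGroup G] [Fintype G] [AddCommGroup H]

lemma card_filter_prod {α β : Type} [Fintype α] [Fintype β] (P : α → β → Prop)
    {i1 : DecidablePred (fun z : α × β => P z.1 z.2)} {i2 : ∀ a, DecidablePred (P a)} :
    ((Finset.univ.filter (fun z : α × β => P z.1 z.2)).card : ℝ)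
      = ∑ a, ((Finset.univ.filter (fun b => P a b)).card : ℝ) := by
  have : (Finset.univ.filter (fun z : α × β => P z.1 z.2)).card
      = ∑ a, (Finset.univ.filter (fun b => P a b)).card := by
    simp_rw [Finset.card_filter]
    rw [Fintype.sum_prod_type]
  exact_mod_cast this

lemma exists_le_avg {α : Type} [Fintype α] [Nonempty α] (f : α → ℝ) (t : ℝ)
    (h : ∑ a, f a ≤ t * Fintype.card α) : ∃ a, f a ≤ t := by
  have : ∃ a ∈ (Finset.univ : Finset α), f a ≤ t := by
    apply Finset.exists_le_of_sum_le Finset.univ_nonempty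
    simpa [mul_comm] using h
  obtain ⟨a, _, ha⟩ := this
  exact ⟨a, ha⟩

lemma blr_pairs (f : G → H) (η : ℝ) (h0 : 0 ≤ η) (h1 : η < 1 / 12)
    (h : ((Finset.univ.filter (fun z : G × G => f (z.1 + z.2) ≠ f z.1 + f z.2)).card : ℝ)
      ≤ η * (Fintype.card G : ℝ) ^ 2) :
    ∃ g : G →+ H, ((Finset.univ.filter (fun x => f x ≠ g x)).card : ℝ)
      ≤ 2 * η * Fintype.card G := by
  have hNpos : (0 : ℝ) < Fintype.card G := by exact_mod_cast Fintype.card_pos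
  have step2 : ∀ x : G, ∃ v : H,
      ((Finset.univ.filter (fun y => f (x + y) - f y ≠ v)).card : ℝ)
        ≤ 2 * η * Fintype.card G := by
    intro x
    have key : ∑ y₂ : G, ((Finset.univ.filter
        (fun y₁ => f (x + y₁) - f y₁ ≠ f (x + y₂) - f y₂)).card : ℝ)
        ≤ (2 * η * Fintype.card G) * Fintype.card G := by
      rw [← card_filter_prod (fun y₂ y₁ : G => f (x + y₁) - f y₁ ≠ f (x + y₂) - f y₂)
        (i1 := fun _ => inferInstance)]
      set B := Finset.univ.filter (fun z : G × G => f (z.1 + z.2) ≠ f z.1 + f z.2) with hB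
      have i1 : (Finset.univ.filter (fun z : G × G => (x + z.2, z.1) ∈ B)).card ≤ B.card := by
        apply Finset.card_le_card_of_injOn (fun z => (x + z.2, z.1))
        · intro z hz; simpa using hz
        · rintro ⟨a, b⟩ _ ⟨c, d⟩ _ h
          simp only [Prod.mk.injEq, add_right_inj] at h
          simp [h]
      have i2 : (Finset.univ.filter (fun z : G × G => (x + z.1, z.2) ∈ B)).card ≤ B.card := by
        apply Finset.card_le_card_of_injOn (fun z => (x + z.1, z.2))
        · intro z hz; simpa using hz
        · rintro ⟨a, b⟩ _ ⟨c, d⟩ _ h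
          simp only [Prod.mk.injEq, add_right_inj] at h
          simp [h]
      have hsub : (Finset.univ.filter (fun z : G × G =>
          f (x + z.2) - f z.2 ≠ f (x + z.1) - f z.1)) ⊆
          (Finset.univ.filter (fun z : G × G => (x + z.2, z.1) ∈ B)) ∪
          (Finset.univ.filter (fun z : G × G => (x + z.1, z.2) ∈ B)) := by
        rintro ⟨y₂, y₁⟩ hz
        simp only [Finset.mem_filter, Finset.mem_univ, true_and, Finset.mem_union, hB] at hz ⊢
        by_contra hcon
        push Not at hcon
        obtain ⟨e1, e2⟩ := hcon
        apply hz
        have : x + y₁ + y₂ = x + y₂ + y₁ := by abel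
        rw [this, e2] at e1
        rw [sub_eq_sub_iff_add_eq_add, ← e1]
      have := (Finset.card_le_card hsub).trans (Finset.card_union_le _ _)
      have h2 : ((Finset.univ.filter (fun z : G × G =>
          f (x + z.2) - f z.2 ≠ f (x + z.1) - f z.1)).card : ℝ) ≤ B.card + B.card := by
        exact_mod_cast this.trans (Nat.add_le_add i1 i2)
      nlinarith
    obtain ⟨y₂, hy⟩ := exists_le_avg _ _ key
    exact ⟨_, hy⟩
  choose g hg using step2
  have hadd : ∀ x z, g (x + z) = g x + g z := by
    intro x z
    by_contra hne
    have hcov : (Finset.univ : Finset G) ⊆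
        ((Finset.univ.filter (fun y => f (x + (z + y)) - f (z + y) ≠ g x)) ∪
        (Finset.univ.filter (fun y => f (z + y) - f y ≠ g z))) ∪
        (Finset.univ.filter (fun y => f ((x + z) + y) - f y ≠ g (x + z))) := by
      intro y _
      simp only [Finset.mem_filter, Finset.mem_univ, true_and, Finset.mem_union]
      by_contra hcon
      push Not at hcon
      obtain ⟨⟨e1, e2⟩, e3⟩ := hcon
      apply hne
      rw [← e1, ← e2, ← e3, add_assoc]
      abel
    have i1 : (Finset.univ.filter (fun y => f (x + (z + y)) - f (z + y) ≠ g x)).card ≤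
        (Finset.univ.filter (fun y => f (x + y) - f y ≠ g x)).card := by
      apply Finset.card_le_card_of_injOn (fun y => z + y)
      · intro y hy; simpa using hy
      · intro a _ b _ h; simpa using h
    have hc := (Finset.card_le_card hcov).trans ((Finset.card_union_le _ _).trans
      (Nat.add_le_add_right (Finset.card_union_le _ _) _))
    have hc' : (Fintype.card G : ℝ) ≤
        (Finset.univ.filter (fun y => f (x + y) - f y ≠ g x)).card +
        (Finset.univ.filter (fun y => f (z + y) - f y ≠ g z)).card +
        (Finset.univ.filter (fun y => f ((x + z) + y) - f y ≠ g (x + z))).card := by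
      rw [Finset.card_univ] at hc
      exact_mod_cast hc.trans (Nat.add_le_add_right (Nat.add_le_add_right i1 _) _)
    have := hg x
    have := hg z
    have := hg (x + z)
    nlinarith
  refine ⟨AddMonoidHom.mk' g hadd, ?_⟩
  simp only [AddMonoidHom.mk'_apply]
  set X := Finset.univ.filter (fun x => f x ≠ g x) with hX
  replace h := (card_filter_prod (fun x y : G => f (x + y) ≠ f x + f y)
    (i1 := fun _ => inferInstance) (i2 := fun _ _ => inferInstance)).symm.trans_le h
  have hX1 : ∀ x ∈ X, (1 - 2 * η) * Fintype.card G ≤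
      ((Finset.univ.filter (fun y => f (x + y) ≠ f x + f y)).card : ℝ) := by
    intro x hx
    rw [hX, Finset.mem_filter] at hx
    have hcov : (Finset.univ : Finset G) ⊆
        (Finset.univ.filter (fun y => f (x + y) - f y ≠ g x)) ∪
        (Finset.univ.filter (fun y => f (x + y) ≠ f x + f y)) := by
      intro y _
      simp only [Finset.mem_filter, Finset.mem_univ, true_and, Finset.mem_union]
      by_contra hcon
      push Not at hcon
      apply hx.2
      rw [← hcon.1, hcon.2]; abel
    have hc := (Finset.card_le_card hcov).trans (Finset.card_union_le _ _)
    rw [Finset.card_univ] at hc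
    have hc' : (Fintype.card G : ℝ) ≤
      (Finset.univ.filter (fun y => f (x + y) - f y ≠ g x)).card +
        (Finset.univ.filter (fun y => f (x + y) ≠ f x + f y)).card := by exact_mod_cast hc
    linarith [hg x]
  have h3 : (X.card : ℝ) * ((1 - 2 * η) * Fintype.card G) ≤ η * (Fintype.card G : ℝ) ^ 2 := by
    refine le_trans ?_ h
    calc (X.card : ℝ) * ((1 - 2 * η) * Fintype.card G)
        = ∑ x ∈ X, ((1 - 2 * η) * Fintype.card G) := by rw [Finset.sum_const, nsmul_eq_mul]
      _ ≤ ∑ x ∈ X, ((Finset.univ.filter (fun y => f (x + y) ≠ f x + f y)).card : ℝ) :=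
          Finset.sum_le_sum hX1
      _ ≤ _ := Finset.sum_le_sum_of_subset_of_nonneg (Finset.subset_univ _)
          (fun _ _ _ => by positivity)
  have h4 : ((X.card : ℝ) * (1 - 2 * η)) * Fintype.card G
      ≤ (η * Fintype.card G) * Fintype.card G := by nlinarith
  have h5 := le_of_mul_le_mul_right h4 hNpos
  have : (0:ℝ) ≤ X.card := by positivity
  nlinarith

lemma blr (Φ : G → H) (η : ℝ) (h0 : 0 ≤ η) (h1 : η < 1 / 12)
    (h : ((Finset.univ.filter (fun z : G × G × G =>
      Φ (z.1 + z.2.1 - z.2.2) ≠ Φ z.1 + Φ z.2.1 - Φ z.2.2)).card : ℝ)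
      ≤ η * (Fintype.card G : ℝ) ^ 3) :
    ∃ (g : G →+ H) (s : H), ((Finset.univ.filter (fun x => Φ x ≠ g x + s)).card : ℝ)
      ≤ 2 * η * Fintype.card G := by
  have e : ((Finset.univ.filter (fun z : G × G × G =>
      Φ (z.1 + z.2.1 - z.2.2) ≠ Φ z.1 + Φ z.2.1 - Φ z.2.2)).card : ℝ) =
      ∑ c : G, ((Finset.univ.filter (fun z : G × G =>
        Φ (z.1 + z.2 - c) ≠ Φ z.1 + Φ z.2 - Φ c)).card : ℝ) := by
    rw [← card_filter_prod (fun (c : G) (z : G × G) => Φ (z.1 + z.2 - c) ≠ Φ z.1 + Φ z.2 - Φ c)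
      (i1 := fun _ => inferInstance)]
    congr 1
    apply Finset.card_bij (fun z _ => (z.2.2, (z.1, z.2.1)))
    · rintro ⟨a, b, c⟩ hz; simpa using hz
    · rintro ⟨a, b, c⟩ _ ⟨a', b', c'⟩ _ h; simp at h; simp [h]
    · rintro ⟨c, a, b⟩ hz; exact ⟨(a, b, c), by simpa using hz, rfl⟩
  rw [e] at h
  obtain ⟨c, hc⟩ := exists_le_avg _ (η * (Fintype.card G : ℝ) ^ 2) (by nlinarith)
  obtain ⟨g, hg⟩ := blr_pairs (fun x => Φ (x + c) - Φ c) η h0 h1 (by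
    refine le_trans ?_ hc
    norm_cast
    apply Finset.card_le_card_of_injOn (fun z => (z.1 + c, z.2 + c))
    · rintro ⟨x, y⟩ hz
      simp only [Finset.coe_filter, Finset.mem_univ, true_and, Set.mem_ofPred_eq] at hz ⊢
      intro hcon
      apply hz
      have : x + c + (y + c) - c = x + y + c := by abel
      rw [this] at hcon
      rw [hcon]; abel
    · rintro ⟨a, b⟩ _ ⟨a', b'⟩ _ h; simpa using h)
  refine ⟨g, Φ c - g c, ?_⟩
  refine le_trans ?_ hg
  norm_cast
  apply Finset.card_le_card_of_injOn (fun x => x - c)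
  · intro x hz
    simp only [Finset.coe_filter, Finset.mem_univ, true_and, Set.mem_ofPred_eq] at hz ⊢
    intro hcon
    apply hz
    rw [sub_add_cancel, map_sub] at hcon
    rw [sub_eq_iff_eq_add] at hcon
    rw [hcon]; abel
  · intro a _ b _ h; simpa using h

end blr

section lift

/-- Lifting from prime moduli to all moduli dividing `N`. -/
lemma lift_affine (N : ℕ) [NeZero N] (A : Finset (ZMod N))
    (hprime : ∀ q : ℕ, q.Prime → q ∣ N → ∀ φ : ZMod N → ZMod q, FreimanHomOn A φ →
      ∃ (g : ZMod N →+ ZMod q) (s : ZMod q), ∀ a ∈ A, φ a = g a + s) :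
    ∀ m : ℕ, 0 < m → m ∣ N → ∀ φ : ZMod N → ℤ,
      (∀ a ∈ A, ∀ b ∈ A, ∀ c ∈ A, ∀ d ∈ A, a + b = c + d →
        (m : ℤ) ∣ φ a + φ b - (φ c + φ d)) →
      ∃ r s : ℤ, ∀ a ∈ A, (m : ℤ) ∣ φ a - (r * (a.val : ℤ) + s) := by
  have hval : ∀ a b c d : ZMod N, a + b = c + d →
      (N : ℤ) ∣ (a.val : ℤ) + b.val - (c.val + d.val) := by
    intro a b c d h
    rw [← ZMod.intCast_zmod_eq_zero_iff_dvd]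
    push_cast
    simp [h]
  intro m
  induction m using Nat.strong_induction_on with
  | _ m ih =>
  intro hm hmN φ hφ
  by_cases h1 : m = 1
  · exact ⟨0, 0, fun a _ => by simp [h1]⟩
  obtain ⟨q, hq, m', rfl⟩ := Nat.exists_prime_and_dvd h1
  have hq0 : 0 < q := hq.pos
  have hm' : 0 < m' := Nat.pos_of_mul_pos_left hm
  obtain ⟨g, s, hgs⟩ := hprime q hq (dvd_trans (dvd_mul_right _ _) hmN) (fun a => (φ a : ZMod q)) (by
    intro a ha b hb c hc d hd h
    have := hφ a ha b hb c hc d hd h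
    have h2 : (q : ℤ) ∣ φ a + φ b - (φ c + φ d) :=
      dvd_trans (by push_cast; exact dvd_mul_right _ _) this
    have h3 := (ZMod.intCast_zmod_eq_zero_iff_dvd _ q).2 h2
    push_cast at h3
    exact sub_eq_zero.1 h3)
  obtain ⟨r₀, hr₀⟩ := ZMod.intCast_surjective (g 1)
  obtain ⟨s₀, hs₀⟩ := ZMod.intCast_surjective s
  have hg : ∀ a : ZMod N, g a = (a.val : ZMod q) * g 1 := by
    intro a
    conv_lhs => rw [← ZMod.natCast_zmod_val a, ← nsmul_one, map_nsmul, nsmul_eq_mul]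
  have hdiv : ∀ a ∈ A, (q : ℤ) ∣ φ a - (r₀ * (a.val : ℤ) + s₀) := by
    intro a ha
    rw [← ZMod.intCast_zmod_eq_zero_iff_dvd]
    push_cast
    rw [hgs a ha, hg, hr₀, hs₀]
    ring
  have hdiv' : ∀ a : ZMod N, ∃ k : ℤ, a ∈ A → φ a - (r₀ * (a.val : ℤ) + s₀) = q * k := by
    intro a
    by_cases ha : a ∈ A
    · obtain ⟨k, hk⟩ := hdiv a ha; exact ⟨k, fun _ => hk⟩
    · exact ⟨0, fun h => absurd h ha⟩
  choose ψ hψ using hdiv'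
  have hlt : m' < q * m' := by
    have := hq.two_le
    nlinarith
  obtain ⟨r', s', h'⟩ := ih m' hlt hm' (dvd_trans (dvd_mul_left _ _) hmN) ψ (by
    intro a ha b hb c hc d hd h
    have e1 := hφ a ha b hb c hc d hd h
    have e2 : ((q * m' : ℕ) : ℤ) ∣ (a.val : ℤ) + b.val - (c.val + d.val) :=
      dvd_trans (by exact_mod_cast hmN) (hval a b c d h)
    have e3 : ((q * m' : ℕ) : ℤ) ∣ (q : ℤ) * (ψ a + ψ b - (ψ c + ψ d)) := by
      have : (q : ℤ) * (ψ a + ψ b - (ψ c + ψ d)) = (φ a + φ b - (φ c + φ d)) -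
          r₀ * ((a.val : ℤ) + b.val - (c.val + d.val)) := by
        linear_combination (-1 : ℤ) * hψ a ha - hψ b hb + hψ c hc + hψ d hd
      rw [this]
      exact dvd_sub e1 (dvd_mul_of_dvd_right e2 _)
    rw [Nat.cast_mul] at e3
    exact (mul_dvd_mul_iff_left (by exact_mod_cast hq0.ne')).1 e3)
  refine ⟨r₀ + q * r', s₀ + q * s', fun a ha => ?_⟩
  obtain ⟨k, hk⟩ := h' a ha
  refine ⟨k, ?_⟩
  push_cast
  linear_combination hψ a ha + q * hk

lemma lift_final (N : ℕ) [NeZero N] (A : Finset (ZMod N))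
    (hprime : ∀ q : ℕ, q.Prime → q ∣ N → ∀ φ : ZMod N → ZMod q, FreimanHomOn A φ →
      ∃ (g : ZMod N →+ ZMod q) (s : ZMod q), ∀ a ∈ A, φ a = g a + s)
    (φ : ZMod N → ZMod N) (hφ : FreimanHomOn A φ) :
    ∃ r s : ZMod N, ∀ a ∈ A, φ a = r * a + s := by
  obtain ⟨r, s, h⟩ := lift_affine N A hprime N (Nat.pos_of_ne_zero (NeZero.ne N)) dvd_rfl
    (fun a => ((φ a).val : ℤ)) (by
      intro a ha b hb c hc d hd h
      rw [← ZMod.intCast_zmod_eq_zero_iff_dvd]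
      push_cast
      simp [hφ a ha b hb c hc d hd h])
  refine ⟨r, s, fun a ha => ?_⟩
  have := h a ha
  rw [← ZMod.intCast_zmod_eq_zero_iff_dvd] at this
  push_cast at this
  simp only [ZMod.natCast_val, ZMod.cast_id', id_eq] at this
  exact sub_eq_zero.1 this

end lift

lemma growth' (ε : ℝ) (hε : 0 < ε) (hε1 : ε ≤ 1) : ∃ κ : ℝ, 0 < κ ∧ κ ≤ ε / 64 ∧
    ∀ (G Ω : Type) [Fintype G] [Fintype Ω] [DecidableEq Ω] (p : ℝ), 0 ≤ p → p ≤ 1 →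
    ∀ (R : G → Finset Ω) (r m M : ℝ), 0 < r → 0 ≤ m →
    (∀ x, ((R x).card : ℝ) ≤ r) →
    (∀ ω, ((Finset.univ.filter (fun x => ω ∈ R x)).card : ℝ) ≤ m) →
    ε * Fintype.card G * r ≤ ∑ x, ((R x).card : ℝ) →
    m * M ≤ ε * Fintype.card G * r / 2 →
    M ≤ κ * (p * Fintype.card G) * r →
    randomSubsetProb G p (fun B => ((B.biUnion R).card : ℝ) < M) ≤
      Real.exp (-(κ * (p * Fintype.card G))) := by
  obtain ⟨κ, h1, h2, h⟩ := growth ε hε hε1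
  refine ⟨κ, h1, h2, ?_⟩
  intro G Ω _ _ dO p h0 hp R r m M hr hm hR hω hs hM1 hM2
  have e : dO = fun a b => Classical.propDecidable (a = b) := Subsingleton.elim _ _
  subst e
  refine h G Ω p h0 hp R r m M hr hm hR (fun ω => ?_) hs hM1 hM2
  convert hω ω

/-- Sprinkling: expose a first round of density `p₁`. -/
lemma pr_round {G : Type} [Fintype G] {p p₁ α β : ℝ} (h0 : 0 ≤ p₁) (h1 : p₁ ≤ p) (h2 : p ≤ 1)
    (h3 : p₁ < 1) (E F : Finset G → Prop)
    (hF : randomSubsetProb G p₁ F ≤ α) (hβ : 0 ≤ β)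
    (hE : ∀ p', p - p₁ ≤ p' → 0 ≤ p' → p' ≤ p → ∀ A₁, ¬ F A₁ →
      randomSubsetProb G p' (fun A₂ => E (A₁ ∪ A₂)) ≤ β) :
    randomSubsetProb G p E ≤ α + β := by
  have h4 : 0 < 1 - p₁ := by linarith
  set p' := (p - p₁) / (1 - p₁) with hp'
  have hp'0 : 0 ≤ p' := div_nonneg (by linarith) h4.le
  have hp'p : p' ≤ p := by
    rw [hp', div_le_iff₀ h4]; nlinarith
  have hp'1 : p - p₁ ≤ p' := by
    rw [hp', le_div_iff₀ h4]; nlinarith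
  refine pr_split_bound (p₁ := p₁) (p₂ := p') ?_ h0 h3.le hp'0 (by linarith) E F hF hβ
    (fun A₁ hA => hE p' hp'1 hp'0 hp'p A₁ hA)
  rw [hp']; field_simp; ring

lemma pr_size {G : Type} [Fintype G] {p : ℝ} (h0 : 0 ≤ p) (h1 : p ≤ 1) :
    randomSubsetProb G p (fun A => 4 * (p * Fintype.card G) ≤ (A.card : ℝ)) ≤
      Real.exp (-(2 * (p * Fintype.card G))) := by
  have := pr_tail h0 h1 (Finset.univ : Finset G) (4 * (p * Fintype.card G))
  simp only [Finset.inter_univ, Finset.card_univ] at this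
  refine this.trans (le_of_eq ?_)
  congr 1; ring

set_option maxHeartbeats 2000000 in
lemma bad_hit (η : ℝ) (hη : 0 < η) (hη1 : η ≤ 1) : ∃ c : ℝ, 0 < c ∧
    ∀ (G : Type) [AddCommGroup G] [Fintype G] (p : ℝ), 0 ≤ p → p ≤ 1 →
    (Fintype.card G : ℝ) ≤ (p / 4 * Fintype.card G) ^ 3 →
    (p / 4 * Fintype.card G) ^ 2 ≤ 8 * Fintype.card G →
    ∀ Bad : Finset (G × G × G), η * (Fintype.card G : ℝ) ^ 3 ≤ Bad.card →
    randomSubsetProb G p (fun A => ¬ ∃ a b c, (a, b, c) ∈ Bad ∧ a ∈ A ∧ b ∈ A ∧ c ∈ A ∧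
      a + b - c ∈ A) ≤ 6 * Real.exp (-(c * (p * Fintype.card G))) := by
  obtain ⟨κ₁, hκ₁, hκ₁', g1⟩ := growth' η hη hη1
  obtain ⟨κ₂, hκ₂, hκ₂', g2⟩ := growth' (κ₁ / 4) (by linarith) (by linarith)
  obtain ⟨κ₃, hκ₃, hκ₃', g3⟩ := growth' (κ₂ / 4) (by linarith) (by linarith)
  refine ⟨κ₃ / 4, by linarith, ?_⟩
  intro G _ _ p h0 h1 hn3 hn2 Bad hBad
  set N : ℝ := (Fintype.card G : ℝ) with hN
  have hNpos : 0 < N := by rw [hN]; exact_mod_cast Fintype.card_pos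
  set q := p / 4 with hq
  have hq0 : 0 ≤ q := by rw [hq]; linarith
  have hqp : q ≤ p := by rw [hq]; linarith
  have hq1 : q < 1 := by rw [hq]; linarith
  set n := q * N with hn
  have hnpos : 0 < n := by
    have hnn : 0 ≤ n := mul_nonneg hq0 hNpos.le
    rcases hnn.eq_or_lt with h | h
    · rw [← h] at hn3; norm_num at hn3; linarith
    · exact h
  have hnN : n ≤ N / 4 := by rw [hn, hq]; nlinarith
  set δ := Real.exp (-(κ₃ * n)) with hδ
  have hδ0 : 0 ≤ δ := (Real.exp_pos _).le
  have hδ' : Real.exp (-(κ₃ / 4 * (p * N))) = δ := by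
    rw [hδ, hn, hq]; congr 1; ring
  rw [hδ']
  have hexp : ∀ t, κ₃ ≤ t → Real.exp (-(t * n)) ≤ δ := fun t ht =>
    Real.exp_le_exp.2 (by nlinarith)
  have hsize : randomSubsetProb G q (fun A => 4 * n ≤ (A.card : ℝ)) ≤ δ := by
    refine (pr_size hq0 hq1.le).trans ?_
    rw [← hN, ← hn, ← neg_mul, neg_mul]
    exact hexp 2 (by linarith)
  -- round 1
  set R1 : G → Finset (G × G × G) := fun a => Bad.filter (fun z => z.1 = a) with hR1
  have r1 : randomSubsetProb G q (fun B => ((B.biUnion R1).card : ℝ) < κ₁ * n * N ^ 2) ≤ δ := by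
    refine (g1 G (G × G × G) q hq0 hq1.le R1 (N ^ 2) 1 (κ₁ * n * N ^ 2) (by positivity) zero_le_one
      ?_ ?_ ?_ ?_ ?_).trans (hexp κ₁ (by linarith))
    · intro a
      have : (R1 a).card ≤ (Finset.univ : Finset (G × G)).card := by
        apply Finset.card_le_card_of_injOn (fun z => z.2)
        · intro z _; simp
        · intro z hz w hw h
          simp only [hR1, Finset.coe_filter, Set.mem_ofPred_eq] at hz hw
          exact Prod.ext (hz.2.trans hw.2.symm) h
      rw [Finset.card_univ, Fintype.card_prod] at this
      have h2 : ((R1 a).card : ℝ) ≤ (Fintype.card G : ℝ) * Fintype.card G := by exact_mod_cast this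
      rw [hN]; nlinarith
    · intro ω
      have : (Finset.univ.filter (fun x => ω ∈ R1 x)).card ≤ 1 := by
        rw [Finset.card_le_one]
        intro a ha b hb
        simp only [hR1, Finset.mem_filter, Finset.mem_univ, true_and] at ha hb
        exact ha.2.symm.trans hb.2
      exact_mod_cast this
    · have : Bad.card = ∑ a, (R1 a).card :=
        Finset.card_eq_sum_card_fiberwise (fun z _ => Finset.mem_coe.2 (Finset.mem_univ _))
      have h2 : (Bad.card : ℝ) = ∑ a, ((R1 a).card : ℝ) := by exact_mod_cast this
      rw [← h2]; nlinarith
    · have : κ₁ * n ≤ η * N / 2 := by nlinarith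
      nlinarith [pow_pos hNpos 2]
    · exact le_rfl
  have goal1 : 6 * δ = (δ + δ) + (4 * δ) := by ring
  rw [goal1]
  refine pr_round hq0 hqp h1 hq1 _ (fun A₁ => ((A₁.biUnion R1).card : ℝ) < κ₁ * n * N ^ 2 ∨
    4 * n ≤ (A₁.card : ℝ)) ((pr_or hq0 hq1.le _ _).trans (add_le_add r1 hsize)) (by linarith) ?_
  intro p₂ hp₂ hp₂0 hp₂p A₁ hA₁
  push Not at hA₁
  obtain ⟨hS1, hA1⟩ := hA₁
  set S1 := A₁.biUnion R1 with hS1def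
  have mS1 : ∀ a b c, (a, b, c) ∈ S1 ↔ a ∈ A₁ ∧ (a, b, c) ∈ Bad := by
    intro a b c
    simp only [hS1def, hR1, Finset.mem_biUnion, Finset.mem_filter]
    constructor
    · rintro ⟨x, hx, h, rfl⟩; exact ⟨hx, h⟩
    · rintro ⟨h1, h2⟩; exact ⟨a, h1, h2, rfl⟩
  -- round 2
  set R2 : G → Finset (G × G) := fun b =>
    Finset.univ.filter (fun w => (w.1 - b, b, w.2) ∈ S1) with hR2
  have r2 : randomSubsetProb G q (fun B => ((B.biUnion R2).card : ℝ) < κ₂ * n * (4 * n * N)) ≤ δ := by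
    refine (g2 G (G × G) q hq0 hq1.le R2 (4 * n * N) (4 * n) (κ₂ * n * (4 * n * N)) (by positivity)
      (by positivity) ?_ ?_ ?_ ?_ ?_).trans (hexp κ₂ (by linarith))
    · intro b
      have : (R2 b).card ≤ (A₁ ×ˢ (Finset.univ : Finset G)).card := by
        apply Finset.card_le_card_of_injOn (fun w => (w.1 - b, w.2))
        · intro w hw
          simp only [hR2, Finset.coe_filter, Set.mem_ofPred_eq, mS1] at hw
          simp [hw.2.1]
        · rintro ⟨a, b⟩ _ ⟨a', b'⟩ _ h
          simpa using h
      rw [Finset.card_product, Finset.card_univ] at this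
      have h2 : ((R2 b).card : ℝ) ≤ (A₁.card : ℝ) * Fintype.card G := by exact_mod_cast this
      rw [← hN] at h2; nlinarith
    · intro ω
      have : (Finset.univ.filter (fun x => ω ∈ R2 x)).card ≤ A₁.card := by
        apply Finset.card_le_card_of_injOn (fun b => ω.1 - b)
        · intro b hb
          simp only [hR2, Finset.coe_filter, Finset.mem_filter, Finset.mem_univ, true_and,
            Set.mem_ofPred_eq, mS1] at hb
          exact hb.1
        · intro a _ b _ h; simpa using h
      have h2 : ((Finset.univ.filter (fun x => ω ∈ R2 x)).card : ℝ) ≤ A₁.card := by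
        exact_mod_cast this
      linarith
    · have e := card_filter_prod (fun (b : G) (w : G × G) => (w.1 - b, b, w.2) ∈ S1)
        (i1 := fun _ => inferInstance) (i2 := fun _ _ => inferInstance)
      have e2 : S1.card ≤ (Finset.univ.filter
          (fun z : G × (G × G) => (z.2.1 - z.1, z.1, z.2.2) ∈ S1)).card := by
        apply Finset.card_le_card_of_injOn (fun w => (w.2.1, (w.1 + w.2.1, w.2.2)))
        · rintro ⟨a, b, c⟩ hw
          simpa using hw
        · rintro ⟨a, b, c⟩ _ ⟨a', b', c'⟩ _ h
          simp only [Prod.mk.injEq] at h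
          obtain ⟨rfl, h2, rfl⟩ := h
          simpa using h2
      have e3 : (S1.card : ℝ) ≤ ∑ b, ((R2 b).card : ℝ) := by
        rw [hR2, ← e]; exact_mod_cast e2
      refine le_trans (le_trans (le_of_eq ?_) hS1) e3
      rw [← hN]; ring
    · have h5 : κ₂ * n ^ 2 ≤ κ₁ / 256 * (8 * N) := by
        apply mul_le_mul _ hn2 (by positivity) (by positivity)
        linarith
      have : 4 * n * (κ₂ * n * (4 * n * N)) = 16 * (κ₂ * n ^ 2) * (n * N) := by ring
      rw [this]
      have h6 : κ₁ / 4 * N * (4 * n * N) / 2 = (κ₁ * N / 2) * (n * N) := by ring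
      rw [h6]
      refine mul_le_mul_of_nonneg_right ?_ (by positivity)
      linarith
    · exact le_rfl
  have goal2 : 4 * δ = (δ + δ) + (2 * δ) := by ring
  rw [goal2]
  refine pr_round hq0 (by linarith) (by linarith) hq1 _
    (fun A₂ => ((A₂.biUnion R2).card : ℝ) < κ₂ * n * (4 * n * N) ∨
    4 * n ≤ (A₂.card : ℝ)) ((pr_or hq0 hq1.le _ _).trans (add_le_add r2 hsize)) (by linarith) ?_
  intro p₃ hp₃ hp₃0 hp₃p A₂ hA₂
  push Not at hA₂
  obtain ⟨hS2, hA2⟩ := hA₂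
  set S2 := A₂.biUnion R2 with hS2def
  have mS2 : ∀ s c, (s, c) ∈ S2 ↔ ∃ b ∈ A₂, s - b ∈ A₁ ∧ (s - b, b, c) ∈ Bad := by
    intro s c
    simp only [hS2def, hR2, Finset.mem_biUnion, Finset.mem_filter, Finset.mem_univ, true_and, mS1]
  -- the set of sums
  set D := (A₁ ×ˢ A₂).image (fun z => z.1 + z.2) with hD
  have hDcard : (D.card : ℝ) ≤ 16 * n ^ 2 := by
    have h1 : D.card ≤ A₁.card * A₂.card := by
      rw [← Finset.card_product]; exact Finset.card_image_le
    have h2 : (D.card : ℝ) ≤ A₁.card * A₂.card := by exact_mod_cast h1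
    have h3 : (A₁.card : ℝ) * A₂.card ≤ (4 * n) * (4 * n) :=
      mul_le_mul hA1.le hA2.le (by positivity) (by positivity)
    nlinarith
  have mD : ∀ s c, (s, c) ∈ S2 → s ∈ D := by
    intro s c h
    obtain ⟨b, hb, ha, _⟩ := (mS2 s c).1 h
    rw [hD, Finset.mem_image]
    exact ⟨(s - b, b), Finset.mem_product.2 ⟨ha, hb⟩, by simp⟩
  -- round 3
  set R3 : G → Finset G := fun c => Finset.univ.filter (fun d => (d + c, c) ∈ S2) with hR3
  have r3 : randomSubsetProb G q (fun B => ((B.biUnion R3).card : ℝ) < 16 * κ₃ * N) ≤ δ := by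
    refine (g3 G G q hq0 hq1.le R3 (16 * n ^ 2) (16 * n ^ 2) (16 * κ₃ * N) (by positivity)
      (by positivity) ?_ ?_ ?_ ?_ ?_)
    · intro c
      refine le_trans ?_ hDcard
      norm_cast
      apply Finset.card_le_card_of_injOn (fun d => d + c)
      · intro d hd
        simp only [hR3, Finset.coe_filter, Finset.mem_univ, true_and, Set.mem_ofPred_eq] at hd
        exact mD _ _ hd
      · intro a _ b _ h; simpa using h
    · intro d
      refine le_trans ?_ hDcard
      norm_cast
      apply Finset.card_le_card_of_injOn (fun c => d + c)
      · intro c hc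
        simp only [hR3, Finset.mem_filter, Finset.coe_filter, Finset.mem_univ, true_and,
          Set.mem_ofPred_eq] at hc
        exact mD _ _ hc
      · intro a _ b _ h; simpa using h
    · have e := card_filter_prod (fun (c d : G) => (d + c, c) ∈ S2)
        (i1 := fun _ => inferInstance) (i2 := fun _ _ => inferInstance)
      have e2 : S2.card ≤ (Finset.univ.filter
          (fun z : G × G => (z.2 + z.1, z.1) ∈ S2)).card := by
        apply Finset.card_le_card_of_injOn (fun w => (w.2, w.1 - w.2))
        · rintro ⟨a, b⟩ hw
          simpa using hw
        · rintro ⟨a, b⟩ _ ⟨a', b'⟩ _ h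
          simp only [Prod.mk.injEq] at h
          obtain ⟨rfl, h2⟩ := h
          simpa using h2
      have e3 : (S2.card : ℝ) ≤ ∑ b, ((R3 b).card : ℝ) := by
        rw [hR3, ← e]; exact_mod_cast e2
      refine le_trans (le_trans (le_of_eq ?_) hS2) e3
      rw [← hN]; ring
    · have : 16 * κ₃ * N ≤ κ₂ / 4 * N / 2 := by nlinarith
      have h2 : 16 * n ^ 2 * (16 * κ₃ * N) ≤ 16 * n ^ 2 * (κ₂ / 4 * N / 2) :=
        mul_le_mul_of_nonneg_left this (by positivity)
      rw [← hN]; linarith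
    · rw [← hN, ← hn]
      have : κ₃ * N ≤ κ₃ * n ^ 3 := mul_le_mul_of_nonneg_left hn3 hκ₃.le
      nlinarith
  have goal3 : 2 * δ = δ + δ := by ring
  rw [goal3]
  refine pr_round hq0 (by linarith) (by linarith) hq1 _
    (fun A₃ => ((A₃.biUnion R3).card : ℝ) < 16 * κ₃ * N) r3 hδ0 ?_
  intro p₄ hp₄ hp₄0 hp₄p A₃ hA₃
  push Not at hA₃
  set T := A₃.biUnion R3 with hT
  have hmono : randomSubsetProb G p₄ (fun A₄ => ¬ ∃ a b c, (a, b, c) ∈ Bad ∧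
      a ∈ A₁ ∪ (A₂ ∪ (A₃ ∪ A₄)) ∧ b ∈ A₁ ∪ (A₂ ∪ (A₃ ∪ A₄)) ∧ c ∈ A₁ ∪ (A₂ ∪ (A₃ ∪ A₄)) ∧
      a + b - c ∈ A₁ ∪ (A₂ ∪ (A₃ ∪ A₄))) ≤ randomSubsetProb G p₄ (fun A₄ => Disjoint A₄ T) := by
    refine pr_mono hp₄0 (by linarith) fun A₄ hA₄ => ?_
    rw [Finset.disjoint_left]
    intro d hd hdT
    apply hA₄
    rw [hT, Finset.mem_biUnion] at hdT
    obtain ⟨c, hc, hdc⟩ := hdT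
    rw [hR3, Finset.mem_filter, mS2] at hdc
    obtain ⟨_, b, hb, ha, hbad⟩ := hdc
    refine ⟨d + c - b, b, c, hbad, ?_, ?_, ?_, ?_⟩
    · simp [ha]
    · simp [hb]
    · simp [hc]
    · simp [hd]
  refine hmono.trans ((pr_avoid hp₄0 (by linarith) T).trans ?_)
  apply Real.exp_le_exp.2
  have h5 : q ≤ p₄ := by rw [hq] at *; linarith
  have h6 : q * (16 * κ₃ * N) ≤ p₄ * T.card :=
    mul_le_mul h5 hA₃ (by positivity) hp₄0
  have h7 : q * (16 * κ₃ * N) = 16 * (κ₃ * n) := by rw [hn]; ring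
  have h8 : 0 < κ₃ * n := by positivity
  linarith

set_option maxHeartbeats 1000000 in
lemma expand_one : ∃ c : ℝ, 0 < c ∧ c ≤ 1 ∧
    ∀ (G : Type) [AddCommGroup G] [Fintype G] (p : ℝ), 0 ≤ p → p ≤ 1 →
    1 ≤ c * (p * Fintype.card G) →
    ∀ Y : Finset G, Y.Nonempty → (Y.card : ℝ) * p ≤ 1 → 8 * (Y.card : ℝ) ≤ Fintype.card G →
    randomSubsetProb G p (fun A => ¬ ∃ a b c, a ∈ A \ Y ∧ b ∈ A \ Y ∧ c ∈ A \ Y ∧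
      a + b - c ∈ Y) ≤ 3 * Real.exp (-(c * (p * Fintype.card G))) +
        Real.exp (-(c * (Y.card * (p * Fintype.card G) ^ 3 / Fintype.card G))) := by
  obtain ⟨κ, hκ, hκ', g1⟩ := growth' (1 / 2) (by norm_num) (by norm_num)
  refine ⟨κ ^ 2 / 54, by positivity, by nlinarith, ?_⟩
  intro G _ _ p h0 h1 hn1 Y hY hYp hYN
  set N : ℝ := (Fintype.card G : ℝ) with hN
  have hNpos : 0 < N := by rw [hN]; exact_mod_cast Fintype.card_pos
  have hYpos : (1 : ℝ) ≤ Y.card := by exact_mod_cast hY.card_pos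
  set c := κ ^ 2 / 54 with hc
  have hc0 : 0 < c := by positivity
  have hcκ : c ≤ κ / 54 := by rw [hc]; nlinarith
  set q := p / 3 with hq
  have hq0 : 0 ≤ q := by rw [hq]; linarith
  have hqp : q ≤ p := by rw [hq]; linarith
  have hq1 : q < 1 := by rw [hq]; linarith
  set n := q * N with hn
  have hpn : p * N = 3 * n := by rw [hn, hq]; ring
  rw [hpn] at hn1 ⊢
  have hnpos : 0 < n := by
    by_contra hcon
    push Not at hcon
    nlinarith
  set δ := Real.exp (-(c * (3 * n))) with hδ
  have hδ0 : 0 ≤ δ := (Real.exp_pos _).le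
  have hκδ : Real.exp (-(κ * n)) ≤ δ := by
    apply Real.exp_le_exp.2
    nlinarith
  set y : ℝ := (Y.card : ℝ) with hy
  have hyn : y * n ≤ N / 3 := by
    have : y * n = (y * p) * N / 3 := by rw [hn, hq]; ring
    rw [this]; nlinarith
  have hκn : 18 ≤ κ ^ 2 * n := by rw [hc] at hn1; linarith
  -- round 1
  set R1 : G → Finset G := fun a => if a ∈ Y then ∅ else Y.image (fun y => a - y) with hR1
  have hR1c : ∀ a, (R1 a).card = if a ∈ Y then 0 else Y.card := by
    intro a
    simp only [hR1]
    split_ifs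
    · simp
    · exact Finset.card_image_of_injective _ (fun u v h => by simpa using h)
  have hsumgen : ∀ (R : G → Finset G) (s : ℝ), 0 ≤ s →
      (∀ a, ((R a).card : ℝ) = if a ∈ Y then 0 else s) →
      1 / 2 * N * s ≤ ∑ a, ((R a).card : ℝ) := by
    intro R s hs hR
    have : ∀ a, ((R a).card : ℝ) = s - (if a ∈ Y then s else 0) := by
      intro a; rw [hR]; split_ifs <;> simp
    simp_rw [this]
    rw [Finset.sum_sub_distrib, Finset.sum_ite_mem, Finset.univ_inter, Finset.sum_const,
      Finset.sum_const, Finset.card_univ, nsmul_eq_mul, nsmul_eq_mul, ← hN, ← hy]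
    nlinarith
  have r1 : randomSubsetProb G q (fun B => ((B.biUnion R1).card : ℝ) < κ * n * y) ≤ δ := by
    refine (g1 G G q hq0 hq1.le R1 y y (κ * n * y) (by linarith) (by linarith)
      ?_ ?_ ?_ ?_ le_rfl).trans hκδ
    · intro a
      rw [hR1c]; split_ifs
      · push_cast; linarith
      · exact le_rfl
    · intro w
      rw [hy]
      norm_cast
      apply Finset.card_le_card_of_injOn (fun a => a - w)
      · intro a ha
        simp only [hR1, Finset.coe_filter, Finset.mem_univ, true_and, Set.mem_ofPred_eq] at ha
        split_ifs at ha with h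
        · simp at ha
        · rw [Finset.mem_image] at ha
          obtain ⟨u, hu, rfl⟩ := ha
          simpa using hu
      · intro a _ b _ h; simpa using h
    · refine hsumgen R1 y (by linarith) ?_
      intro a; rw [hR1c]; split_ifs <;> simp [hy]
    · have : κ * n * y ≤ N / 4 := by nlinarith
      rw [← hN]
      nlinarith
  have goal1 : 3 * δ + Real.exp (-(c * (y * (3 * n) ^ 3 / N))) =
    δ + (δ + (δ + Real.exp (-(c * (y * (3 * n) ^ 3 / N))))) := by ring
  rw [goal1]
  set δ' := Real.exp (-(c * (y * (3 * n) ^ 3 / N))) with hδ'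
  have hδ'0 : 0 ≤ δ' := (Real.exp_pos _).le
  refine pr_round hq0 hqp h1 hq1 _ (fun A₁ => ((A₁.biUnion R1).card : ℝ) < κ * n * y) r1
    (by linarith) ?_
  intro p₂ hp₂ hp₂0 hp₂p A₁ hA₁
  push Not at hA₁
  set S := A₁.biUnion R1 with hS
  have mS : ∀ u, u ∈ S → ∃ a ∈ A₁, a ∉ Y ∧ a - u ∈ Y := by
    intro u hu
    rw [hS, Finset.mem_biUnion] at hu
    obtain ⟨a, ha, hu⟩ := hu
    simp only [hR1] at hu
    split_ifs at hu with h
    · simp at hu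
    · rw [Finset.mem_image] at hu
      obtain ⟨v, hv, rfl⟩ := hu
      exact ⟨a, ha, h, by simpa using hv⟩
  set s : ℝ := (S.card : ℝ) with hs
  have hspos : 0 < s := lt_of_lt_of_le (by positivity) hA₁
  -- round 2
  set R2 : G → Finset G := fun a => if a ∈ Y then ∅ else S.image (fun y => a + y) with hR2
  have hR2c : ∀ a, (R2 a).card = if a ∈ Y then 0 else S.card := by
    intro a
    simp only [hR2]
    split_ifs
    · simp
    · exact Finset.card_image_of_injective _ (fun u v h => by simpa using h)
  set M := min (κ * n * s) (N / 4) with hM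
  have r2 : randomSubsetProb G q (fun B => ((B.biUnion R2).card : ℝ) < M) ≤ δ := by
    refine (g1 G G q hq0 hq1.le R2 s s M hspos hspos.le
      ?_ ?_ ?_ ?_ ?_).trans hκδ
    · intro a
      rw [hR2c]; split_ifs
      · simp [hspos.le]
      · exact le_rfl
    · intro w
      rw [hs]
      norm_cast
      apply Finset.card_le_card_of_injOn (fun a => w - a)
      · intro a ha
        simp only [hR2, Finset.coe_filter, Finset.mem_univ, true_and, Set.mem_ofPred_eq] at ha
        split_ifs at ha with h
        · simp at ha
        · rw [Finset.mem_image] at ha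
          obtain ⟨u, hu, rfl⟩ := ha
          simpa using hu
      · intro a _ b _ h; simpa using h
    · refine hsumgen R2 s hspos.le ?_
      intro a; rw [hR2c]; split_ifs <;> simp [hs]
    · have : M ≤ N / 4 := min_le_right _ _
      rw [← hN]
      nlinarith
    · exact min_le_left _ _
  refine pr_round hq0 (by linarith) (by linarith) hq1 _
    (fun A₂ => ((A₂.biUnion R2).card : ℝ) < M) r2 (by linarith) ?_
  intro p₃ hp₃ hp₃0 hp₃p A₂ hA₂
  push Not at hA₂
  set T := A₂.biUnion R2 with hT
  have hmono : randomSubsetProb G p₃ (fun A₃ => ¬ ∃ a b c,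
      a ∈ (A₁ ∪ (A₂ ∪ A₃)) \ Y ∧ b ∈ (A₁ ∪ (A₂ ∪ A₃)) \ Y ∧ c ∈ (A₁ ∪ (A₂ ∪ A₃)) \ Y ∧
      a + b - c ∈ Y) ≤ randomSubsetProb G p₃ (fun A₃ => Disjoint A₃ (T \ Y)) := by
    refine pr_mono hp₃0 (by linarith) fun A₃ hA₃ => ?_
    rw [Finset.disjoint_left]
    intro d hd hdT
    apply hA₃
    rw [Finset.mem_sdiff, hT, Finset.mem_biUnion] at hdT
    obtain ⟨⟨b, hb, hdb⟩, hdY⟩ := hdT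
    simp only [hR2] at hdb
    split_ifs at hdb with hbY
    · simp at hdb
    rw [Finset.mem_image] at hdb
    obtain ⟨u, hu, rfl⟩ := hdb
    obtain ⟨a, ha, haY, hau⟩ := mS u hu
    refine ⟨a, b, b + u, ?_, ?_, ?_, ?_⟩
    · simp [ha, haY]
    · simp [hb, hbY]
    · simp [hd, hdY]
    · have : a + b - (b + u) = a - u := by abel
      rwa [this]
  refine hmono.trans ((pr_avoid hp₃0 (by linarith) _).trans ?_)
  have hqp3 : q ≤ p₃ := by rw [hq] at *; linarith
  have hTY : M - y ≤ ((T \ Y).card : ℝ) := by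
    have := Finset.le_card_sdiff Y T
    have h3 : T.card ≤ (T \ Y).card + Y.card := by omega
    have : (T.card : ℝ) ≤ (T \ Y).card + Y.card := by exact_mod_cast h3
    linarith
  have hexp : Real.exp (-(p₃ * ((T \ Y).card : ℝ))) ≤ Real.exp (-(q * (M - y))) := by
    apply Real.exp_le_exp.2
    have h3 : q * (M - y) ≤ q * ((T \ Y).card : ℝ) := mul_le_mul_of_nonneg_left hTY hq0
    have h4 : q * ((T \ Y).card : ℝ) ≤ p₃ * ((T \ Y).card : ℝ) :=
      mul_le_mul_of_nonneg_right hqp3 (by positivity)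
    linarith
  refine hexp.trans ?_
  rcases le_total (κ * n * s) (N / 4) with hcase | hcase
  · have hMe : M = κ * n * s := min_eq_left hcase
    have h5 : κ * n * (κ * n * y) ≤ M := by
      rw [hMe]; exact mul_le_mul_of_nonneg_left hA₁ (by positivity)
    have h6 : 1 ≤ n := by nlinarith
    have h7 : 2 ≤ κ ^ 2 * n ^ 2 := by nlinarith
    have h8 : κ ^ 2 * n ^ 2 * y / 2 ≤ M - y := by nlinarith
    have h9 : q * (κ ^ 2 * n ^ 2 * y / 2) ≤ q * (M - y) := mul_le_mul_of_nonneg_left h8 hq0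
    have h10 : q = n / N := by rw [hn]; field_simp
    have h11 : c * (y * (3 * n) ^ 3 / N) = q * (κ ^ 2 * n ^ 2 * y / 2) := by
      rw [h10, hc]; field_simp; ring
    have : Real.exp (-(q * (M - y))) ≤ δ' := by
      apply Real.exp_le_exp.2
      rw [h11]; linarith
    linarith
  · have hMe : M = N / 4 := min_eq_right hcase
    have h8 : N / 8 ≤ M - y := by rw [hMe]; linarith
    have h9 : q * (N / 8) ≤ q * (M - y) := mul_le_mul_of_nonneg_left h8 hq0
    have : Real.exp (-(q * (M - y))) ≤ δ := by
      apply Real.exp_le_exp.2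
      have : q * (N / 8) = n / 8 := by rw [hn]; ring
      nlinarith
    linarith

/-- Expansion property of a set `A` at scale `t`. -/
def Expands {G : Type} [AddCommGroup G] (A : Finset G) (t : ℝ) : Prop :=
  ∀ Y ⊆ A, Y.Nonempty → (Y.card : ℝ) ≤ t →
    ∃ a b c, a ∈ A \ Y ∧ b ∈ A \ Y ∧ c ∈ A \ Y ∧ a + b - c ∈ Y

lemma expand_all : ∃ c ε : ℝ, 0 < c ∧ c ≤ 1 ∧ 0 < ε ∧ ε ≤ 1 ∧
    ∀ (G : Type) [AddCommGroup G] [Fintype G] (p : ℝ), 0 ≤ p → p ≤ 1 →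
    1 ≤ c * (p * Fintype.card G) → (p * Fintype.card G) * p ≤ 1 →
    Real.exp (-(c * ((p * Fintype.card G) ^ 3 / Fintype.card G))) ≤ 1 / Fintype.card G →
    randomSubsetProb G p (fun A => ¬ Expands A (ε * (p * Fintype.card G))) ≤
      3 * Real.exp (-(c * (p * Fintype.card G))) + (Real.exp p - 1) := by
  obtain ⟨c, hc, hc1, H⟩ := expand_one
  set L := Real.log (4 / c) with hLdef
  have h4 : 1 ≤ 4 / c := by rw [le_div_iff₀ hc]; linarith
  have hL : 0 ≤ L := Real.log_nonneg h4
  have heL : Real.exp (-L) = c / 4 := by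
    rw [Real.exp_neg, Real.exp_log (by positivity)]; field_simp
  have hε1 : c / (8 * (L + 1)) ≤ 1 / 8 := by
    rw [div_le_div_iff₀ (by positivity) (by positivity)]; nlinarith
  refine ⟨c / 2, c / (8 * (L + 1)), by linarith, by linarith, by positivity, by linarith, ?_⟩
  set ε := c / (8 * (L + 1)) with hε
  have hεL : ε * (L + 1) = c / 8 := by rw [hε]; field_simp
  have hε0 : 0 < ε := by positivity
  intro G _ _ p h0 h1 hn1 hnp hN3
  set N : ℝ := (Fintype.card G : ℝ) with hN
  have hNpos : 0 < N := by rw [hN]; exact_mod_cast Fintype.card_pos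
  set n := p * N with hn
  have hn0 : 0 ≤ n := by positivity
  set s : Finset (Finset G) := Finset.univ.filter
    (fun Y => Y.Nonempty ∧ (Y.card : ℝ) ≤ ε * n) with hs
  have step1 : randomSubsetProb G p (fun A => ¬ Expands A (ε * n)) ≤
      randomSubsetProb G p (fun A => ∃ Y ∈ s, Y ⊆ A ∧
        ¬ ∃ a b c, a ∈ A \ Y ∧ b ∈ A \ Y ∧ c ∈ A \ Y ∧ a + b - c ∈ Y) := by
    refine pr_mono h0 h1 fun A hA => ?_
    unfold Expands at hA
    push Not at hA
    obtain ⟨Y, hYA, hY, hYc, h⟩ := hA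
    refine ⟨Y, by simp [hs, hY, hYc], hYA, ?_⟩
    push Not
    exact h
  refine step1.trans ((pr_compress h0 h1 s (fun Y B => ¬ ∃ a b c, a ∈ B ∧ b ∈ B ∧ c ∈ B ∧
    a + b - c ∈ Y)).trans ?_)
  have step2 : ∀ Y ∈ s, p ^ Y.card * randomSubsetProb G p (fun A => ¬ ∃ a b c, a ∈ A \ Y ∧
      b ∈ A \ Y ∧ c ∈ A \ Y ∧ a + b - c ∈ Y) ≤
      p ^ Y.card * (3 * Real.exp (-(c * n))) + (p * (1 / N)) ^ Y.card := by
    intro Y hY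
    rw [hs, Finset.mem_filter] at hY
    obtain ⟨_, hYne, hYc⟩ := hY
    have hYn : (Y.card : ℝ) ≤ n := by nlinarith
    have hnN : n ≤ N := by rw [hn]; nlinarith
    have := H G p h0 h1 (by rw [← hN, ← hn]; linarith) Y hYne (by nlinarith) (by
      rw [← hN]; nlinarith)
    rw [mul_pow, ← mul_add]
    refine mul_le_mul_of_nonneg_left (this.trans ?_) (pow_nonneg h0 _)
    rw [← hN, ← hn]
    gcongr
    have e : Real.exp (-(c * (Y.card * n ^ 3 / N))) = (Real.exp (-(c * (n ^ 3 / N)))) ^ Y.card := by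
      rw [← Real.exp_nat_mul]; congr 1; ring
    rw [e]
    refine pow_le_pow_left₀ (Real.exp_pos _).le (le_trans ?_ hN3) _
    apply Real.exp_le_exp.2
    have : 0 ≤ n ^ 3 / N := by positivity
    nlinarith
  refine (Finset.sum_le_sum step2).trans ?_
  rw [Finset.sum_add_distrib, ← Finset.sum_mul]
  refine add_le_add ?_ ?_
  · have h2 := sum_small h0 L (ε * n) hL s (fun K hK => by
      rw [hs, Finset.mem_filter] at hK; exact hK.2.2)
    rw [← hN, ← hn, heL] at h2
    calc _ ≤ Real.exp (L * (ε * n) + c / 4 * n) * (3 * Real.exp (-(c * n))) := by gcongr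
      _ = 3 * Real.exp (L * (ε * n) + c / 4 * n + -(c * n)) := by rw [Real.exp_add (_ + _)]; ring
      _ ≤ _ := by
        gcongr
        have : (ε * (L + 1)) * n = c / 8 * n := by rw [hεL]
        have : 0 ≤ ε * n := by positivity
        nlinarith
  · have h2 := sum_pow_card (G := G) (p * (1 / N))
    have h3 : ∑ K : Finset G, (p * (1 / N)) ^ K.card =
        ∑ K ∈ Finset.univ.erase (∅ : Finset G), (p * (1 / N)) ^ K.card + 1 := by
      rw [← Finset.sum_erase_add _ _ (Finset.mem_univ (∅ : Finset G))]; simp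
    have h4 : ∑ K ∈ s, (p * (1 / N)) ^ K.card ≤
        ∑ K ∈ Finset.univ.erase (∅ : Finset G), (p * (1 / N)) ^ K.card := by
      apply Finset.sum_le_sum_of_subset_of_nonneg
      · intro K hK
        rw [hs, Finset.mem_filter] at hK
        simp [hK.2.1.ne_empty]
      · intro K _ _; positivity
    have h5 : (1 + p * (1 / N)) ^ Fintype.card G ≤ Real.exp p := by
      have h6 : 1 + p * (1 / N) ≤ Real.exp (p * (1 / N)) := by
        have := Real.add_one_le_exp (p * (1 / N)); linarith
      calc _ ≤ Real.exp (p * (1 / N)) ^ Fintype.card G :=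
            pow_le_pow_left₀ (by positivity) h6 _
        _ = Real.exp p := by
          rw [← Real.exp_nat_mul, ← hN]; congr 1; field_simp
    linarith

section algebra
variable {G F : Type} [AddCommGroup G] [Fintype G] [Field F]

/-- `φ` agrees with an affine map on `A`. -/
def AffineOn (A : Finset G) (φ : G → F) : Prop :=
  ∃ (g : G →+ F) (s : F), ∀ a ∈ A, φ a = g a + s

/-- Functions determined by representations, which are Freiman homomorphisms on `U`. -/
def FrSpace (ra rb rc : G → G) (U : Finset G) : Submodule F (G → F) where
  carrier := {Φ | (∀ x, Φ x = Φ (ra x) + Φ (rb x) - Φ (rc x)) ∧ FreimanHomOn U Φ}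
  zero_mem' := by
    refine ⟨fun x => by simp, ?_⟩
    intro a _ b _ c _ d _ _; simp
  add_mem' := by
    rintro Φ Ψ ⟨h1, h2⟩ ⟨h3, h4⟩
    refine ⟨fun x => ?_, ?_⟩
    · simp only [Pi.add_apply]
      conv_lhs => rw [h1 x, h3 x]
      ring
    · intro a ha b hb c hc d hd h
      have e1 := h2 a ha b hb c hc d hd h
      have e2 := h4 a ha b hb c hc d hd h
      simp only [Pi.add_apply]
      linear_combination e1 + e2
  smul_mem' := by
    rintro t Φ ⟨h1, h2⟩
    refine ⟨fun x => ?_, ?_⟩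
    · simp only [Pi.smul_apply, smul_eq_mul]
      conv_lhs => rw [h1 x]
      ring
    · intro a ha b hb c hc d hd h
      have e1 := h2 a ha b hb c hc d hd h
      simp only [Pi.smul_apply, smul_eq_mul]
      linear_combination t * e1

lemma mem_FrSpace (ra rb rc : G → G) (U : Finset G) (Φ : G → F) :
    Φ ∈ FrSpace (F := F) ra rb rc U ↔
      (∀ x, Φ x = Φ (ra x) + Φ (rb x) - Φ (rc x)) ∧ FreimanHomOn U Φ := Iff.rfl

lemma finrank_FrSpace (ra rb rc : G → G) (A U : Finset G) (ha : ∀ x, ra x ∈ A)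
    (hb : ∀ x, rb x ∈ A) (hc : ∀ x, rc x ∈ A) :
    Module.finrank F (FrSpace (F := F) ra rb rc U) ≤ A.card := by
  let f : (FrSpace (F := F) ra rb rc U) →ₗ[F] (A → F) :=
    { toFun := fun Φ a => Φ.1 a.1
      map_add' := fun _ _ => rfl
      map_smul' := fun _ _ => rfl }
  have hf : Function.Injective f := by
    intro Φ Ψ h
    have h' : ∀ a ∈ A, Φ.1 a = Ψ.1 a := fun a ha => congrFun h ⟨a, ha⟩
    apply Subtype.ext
    funext x
    rw [Φ.2.1 x, Ψ.2.1 x, h' _ (ha x), h' _ (hb x), h' _ (hc x)]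
  have := LinearMap.finrank_le_finrank_of_injective hf
  simpa using this

lemma FrSpace_anti (ra rb rc : G → G) {U W : Finset G} (h : U ⊆ W) :
    FrSpace (F := F) ra rb rc W ≤ FrSpace (F := F) ra rb rc U := by
  rintro Φ ⟨h1, h2⟩
  exact ⟨h1, fun a ha b hb c hc d hd => h2 a (h ha) b (h hb) c (h hc) d (h hd)⟩

lemma dim_compress (ra rb rc : G → G) (A₀ A₂ : Finset G) (ha : ∀ x, ra x ∈ A₀)
    (hb : ∀ x, rb x ∈ A₀) (hc : ∀ x, rc x ∈ A₀) :
    ∃ K ⊆ A₂, K.card ≤ 4 * A₀.card ∧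
      FrSpace (F := F) ra rb rc (A₀ ∪ K) = FrSpace (F := F) ra rb rc (A₀ ∪ A₂) := by
  set d : Finset G → ℕ := fun K => Module.finrank F (FrSpace (F := F) ra rb rc (A₀ ∪ K)) with hd
  obtain ⟨K, hK, hmin⟩ := Finset.exists_min_image
    (A₂.powerset.filter (fun K => K.card + 4 * d K ≤ 4 * A₀.card)) d
    ⟨∅, by
      rw [Finset.mem_filter]
      refine ⟨by simp, ?_⟩
      have : d ∅ ≤ A₀.card := finrank_FrSpace (F := F) ra rb rc A₀ (A₀ ∪ ∅) ha hb hc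
      simp only [Finset.card_empty]
      omega⟩
  rw [Finset.mem_filter, Finset.mem_powerset] at hK
  refine ⟨K, hK.1, by omega, ?_⟩
  by_contra hne
  have hle : FrSpace (F := F) ra rb rc (A₀ ∪ A₂) ≤ FrSpace (F := F) ra rb rc (A₀ ∪ K) :=
    FrSpace_anti ra rb rc (Finset.union_subset_union_right hK.1)
  have hlt : ¬ FrSpace (F := F) ra rb rc (A₀ ∪ K) ≤ FrSpace (F := F) ra rb rc (A₀ ∪ A₂) :=
    fun h => hne (le_antisymm h hle)
  rw [SetLike.not_le_iff_exists] at hlt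
  obtain ⟨Φ, hΦ, hΦ2⟩ := hlt
  rw [mem_FrSpace] at hΦ2
  have : ¬ FreimanHomOn (A₀ ∪ A₂) Φ := fun h => hΦ2 ⟨hΦ.1, h⟩
  unfold FreimanHomOn at this
  push Not at this
  obtain ⟨x, hx, y, hy, z, hz, w, hw, hsum, hviol⟩ := this
  set Q : Finset G := ({x, y, z, w} : Finset G) ∩ A₂ with hQ
  have hQ4 : Q.card ≤ 4 := (Finset.card_le_card Finset.inter_subset_left).trans Finset.card_le_four
  set K' := K ∪ Q with hK'
  have hin : ∀ v ∈ ({x, y, z, w} : Finset G), v ∈ A₀ ∪ A₂ → v ∈ A₀ ∪ K' := by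
    intro v hv hv2
    rw [Finset.mem_union] at hv2 ⊢
    rcases hv2 with h | h
    · exact Or.inl h
    · right
      rw [hK', Finset.mem_union, hQ, Finset.mem_inter]
      exact Or.inr ⟨hv, h⟩
  have hsub : FrSpace (F := F) ra rb rc (A₀ ∪ K') < FrSpace (F := F) ra rb rc (A₀ ∪ K) := by
    refine lt_of_le_not_ge (FrSpace_anti ra rb rc
      (Finset.union_subset_union_right Finset.subset_union_left)) ?_
    intro h
    apply hviol
    exact (h hΦ).2 x (hin x (by simp) hx) y (hin y (by simp) hy) z (hin z (by simp) hz)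
      w (hin w (by simp) hw) hsum
  have hdlt : d K' < d K := Submodule.finrank_lt_finrank_of_lt hsub
  have hcard : K'.card ≤ K.card + 4 := (Finset.card_union_le _ _).trans (by omega)
  have := hmin K' (by
    rw [Finset.mem_filter, Finset.mem_powerset]
    refine ⟨Finset.union_subset hK.1 Finset.inter_subset_right, ?_⟩
    omega)
  omega

lemma compress_choice (A₀ : Finset G)
    (hgood : ∀ x : G, ∃ a ∈ A₀, ∃ b ∈ A₀, ∃ c ∈ A₀, x = a + b - c) :
    ∃ Ψ : Finset G → (G → F), ∀ A₂ : Finset G,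
      (∃ φ : G → F, FreimanHomOn (A₀ ∪ A₂) φ ∧ ¬ AffineOn (A₀ ∪ A₂) φ) →
      ∃ K ⊆ A₂, K.card ≤ 4 * A₀.card ∧ FreimanHomOn (A₀ ∪ A₂) (Ψ K) ∧
        ¬ AffineOn A₀ (Ψ K) := by
  choose ra ha rb hb rc hc hx using hgood
  have hch : ∀ K : Finset G, ∃ Φ : G → F,
      (∃ Φ' : G → F, Φ' ∈ FrSpace (F := F) ra rb rc (A₀ ∪ K) ∧ ¬ AffineOn Finset.univ Φ') →
      (Φ ∈ FrSpace (F := F) ra rb rc (A₀ ∪ K) ∧ ¬ AffineOn Finset.univ Φ) := by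
    intro K
    by_cases h : ∃ Φ' : G → F, Φ' ∈ FrSpace (F := F) ra rb rc (A₀ ∪ K) ∧ ¬ AffineOn Finset.univ Φ'
    · obtain ⟨Φ, hΦ⟩ := h
      exact ⟨Φ, fun _ => hΦ⟩
    · exact ⟨0, fun h' => absurd h' h⟩
  choose Ψ hΨ using hch
  refine ⟨Ψ, ?_⟩
  rintro A₂ ⟨φ, hφ, hna⟩
  obtain ⟨K, hKA, hKc, hV⟩ := dim_compress (F := F) ra rb rc A₀ A₂ ha hb hc
  refine ⟨K, hKA, hKc, ?_⟩
  set Φ : G → F := fun x => φ (ra x) + φ (rb x) - φ (rc x) with hΦ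
  have hΦφ : ∀ a ∈ A₀ ∪ A₂, Φ a = φ a := by
    intro a haA
    have := hφ (ra a) (Finset.mem_union_left _ (ha a)) (rb a) (Finset.mem_union_left _ (hb a))
      (rc a) (Finset.mem_union_left _ (hc a)) a haA (by
        rw [add_comm (rc a)]; exact sub_eq_iff_eq_add.1 (hx a).symm)
    simp only [hΦ]
    rw [this]; ring
  have hΦV : Φ ∈ FrSpace (F := F) ra rb rc (A₀ ∪ A₂) := by
    refine ⟨fun x => ?_, ?_⟩
    · rw [hΦφ _ (Finset.mem_union_left _ (ha x)), hΦφ _ (Finset.mem_union_left _ (hb x)),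
        hΦφ _ (Finset.mem_union_left _ (hc x))]
    · intro a ha b hb c hc d hd h
      rw [hΦφ a ha, hΦφ b hb, hΦφ c hc, hΦφ d hd]
      exact hφ a ha b hb c hc d hd h
  have hΦn : ¬ AffineOn Finset.univ Φ := by
    rintro ⟨g, s, h⟩
    apply hna
    exact ⟨g, s, fun a ha => by rw [← hΦφ a ha]; exact h a (Finset.mem_univ _)⟩
  obtain ⟨hm, hn⟩ := hΨ K ⟨Φ, by rw [hV]; exact hΦV, hΦn⟩
  rw [hV] at hm
  refine ⟨hm.2, ?_⟩
  rintro ⟨g, s, h⟩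
  apply hn
  refine ⟨g, s, fun x _ => ?_⟩
  rw [hm.1 x, h _ (ha x), h _ (hb x), h _ (hc x)]
  conv_rhs => rw [hx x]
  rw [map_sub, map_add]; ring

lemma expands_affine (A : Finset G) (t : ℝ) (hA : Expands A t) (Φ : G → F)
    (hΦ : FreimanHomOn A Φ) (g : G →+ F) (s : F)
    (h : ((A.filter (fun a => Φ a ≠ g a + s)).card : ℝ) ≤ t) : ∀ a ∈ A, Φ a = g a + s := by
  intro a ha
  by_contra hne
  obtain ⟨x, y, z, hx, hy, hz, hxyz⟩ := hA (A.filter (fun a => Φ a ≠ g a + s))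
    (Finset.filter_subset _ _) ⟨a, Finset.mem_filter.2 ⟨ha, hne⟩⟩ h
  have aux : ∀ w, w ∈ A \ (A.filter (fun a => Φ a ≠ g a + s)) → w ∈ A ∧ Φ w = g w + s := by
    intro w hw
    rw [Finset.mem_sdiff, Finset.mem_filter] at hw
    refine ⟨hw.1, ?_⟩
    by_contra h'
    exact hw.2 ⟨hw.1, h'⟩
  obtain ⟨hxA, ex⟩ := aux x hx
  obtain ⟨hyA, ey⟩ := aux y hy
  obtain ⟨hzA, ez⟩ := aux z hz
  rw [Finset.mem_filter] at hxyz
  apply hxyz.2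
  have := hΦ x hxA y hyA (x + y - z) hxyz.1 z hzA (by abel)
  rw [ex, ey, ez] at this
  rw [map_sub, map_add]
  linear_combination -this

end algebra

/-- Triples violating the Freiman relation. -/
def badT {G F : Type} [AddCommGroup G] [Fintype G] [Field F] (Φ : G → F) : Finset (G × G × G) :=
  Finset.univ.filter (fun z : G × G × G =>
      Φ (z.1 + z.2.1 - z.2.2) ≠ Φ z.1 + Φ z.2.1 - Φ z.2.2)

lemma card_avoid {G : Type} [AddCommGroup G] [Fintype G] (B : Finset (G × G × G)) (K : Finset G) :
    (B.card : ℝ) - 4 * K.card * (Fintype.card G : ℝ) ^ 2 ≤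
      ((B.filter (fun z => z.1 ∉ K ∧ z.2.1 ∉ K ∧ z.2.2 ∉ K ∧ z.1 + z.2.1 - z.2.2 ∉ K)).card : ℝ) := by
  set B' := B.filter (fun z => z.1 ∉ K ∧ z.2.1 ∉ K ∧ z.2.2 ∉ K ∧ z.1 + z.2.1 - z.2.2 ∉ K) with hB'
  set P : Finset (G × G × G) := K ×ˢ (Finset.univ : Finset (G × G)) with hP
  have hPc : P.card = K.card * (Fintype.card G * Fintype.card G) := by
    rw [hP, Finset.card_product, Finset.card_univ, Fintype.card_prod]
  have hcov : B ⊆ B' ∪ (P ∪ (P.image (fun z => (z.2.1, z.1, z.2.2)) ∪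
      (P.image (fun z => (z.2.1, z.2.2, z.1)) ∪
       P.image (fun z => (z.2.1, z.1 - z.2.1 + z.2.2, z.2.2))))) := by
    rintro ⟨a, b, c⟩ hz
    by_cases h1 : a ∈ K
    · simp [hP, h1]
    by_cases h2 : b ∈ K
    · refine Finset.mem_union_right _ (Finset.mem_union_right _ (Finset.mem_union_left _ ?_))
      exact Finset.mem_image.2 ⟨(b, a, c), by simp [hP, h2], rfl⟩
    by_cases h3 : c ∈ K
    · refine Finset.mem_union_right _ (Finset.mem_union_right _ (Finset.mem_union_right _
        (Finset.mem_union_left _ ?_)))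
      exact Finset.mem_image.2 ⟨(c, a, b), by simp [hP, h3], rfl⟩
    by_cases h4 : a + b - c ∈ K
    · refine Finset.mem_union_right _ (Finset.mem_union_right _ (Finset.mem_union_right _
        (Finset.mem_union_right _ ?_)))
      refine Finset.mem_image.2 ⟨(a + b - c, a, c), by simp [hP, h4], ?_⟩
      simp; abel
    · refine Finset.mem_union_left _ ?_
      rw [hB', Finset.mem_filter]
      exact ⟨hz, h1, h2, h3, h4⟩
  have h1 := Finset.card_le_card hcov
  have h2 := Finset.card_union_le B' (P ∪ (P.image (fun z => (z.2.1, z.1, z.2.2)) ∪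
      (P.image (fun z => (z.2.1, z.2.2, z.1)) ∪
       P.image (fun z => (z.2.1, z.1 - z.2.1 + z.2.2, z.2.2)))))
  have h3 := Finset.card_union_le P (P.image (fun z => (z.2.1, z.1, z.2.2)) ∪
      (P.image (fun z => (z.2.1, z.2.2, z.1)) ∪
       P.image (fun z => (z.2.1, z.1 - z.2.1 + z.2.2, z.2.2))))
  have h4 := Finset.card_union_le (P.image (fun z => (z.2.1, z.1, z.2.2)))
      (P.image (fun z => (z.2.1, z.2.2, z.1)) ∪
       P.image (fun z => (z.2.1, z.1 - z.2.1 + z.2.2, z.2.2)))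
  have h5 := Finset.card_union_le (P.image (fun z => (z.2.1, z.2.2, z.1)))
       (P.image (fun z => (z.2.1, z.1 - z.2.1 + z.2.2, z.2.2)))
  have i1 := Finset.card_image_le (s := P) (f := fun z => (z.2.1, z.1, z.2.2))
  have i2 := Finset.card_image_le (s := P) (f := fun z => (z.2.1, z.2.2, z.1))
  have i3 := Finset.card_image_le (s := P) (f := fun z => (z.2.1, z.1 - z.2.1 + z.2.2, z.2.2))
  have h6 : B.card ≤ B'.card + 4 * P.card := by omega
  rw [hPc] at h6
  have h7 : (B.card : ℝ) ≤ B'.card + 4 * (K.card * (Fintype.card G * Fintype.card G)) := by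
    exact_mod_cast h6
  nlinarith

set_option maxHeartbeats 1000000 in
lemma main_round (ε : ℝ) (hε : 0 < ε) (hε1 : ε ≤ 1) : ∃ ε₁ c : ℝ, 0 < ε₁ ∧ ε₁ ≤ 1 / 2 ∧ 0 < c ∧
    ∀ (G : Type) [AddCommGroup G] [Fintype G] (p n : ℝ), 0 ≤ p → p ≤ 1 →
    p * Fintype.card G ≤ n → n ≤ 2 * (p * Fintype.card G) →
    (Fintype.card G : ℝ) ≤ (p / 4 * Fintype.card G) ^ 3 →
    (p / 4 * Fintype.card G) ^ 2 ≤ 8 * Fintype.card G →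
    ∀ (F : Type) [Field F] (A₀ : Finset G), (A₀.card : ℝ) ≤ 4 * (ε₁ * n) →
    (∀ x : G, ∃ a ∈ A₀, ∃ b ∈ A₀, ∃ c ∈ A₀, x = a + b - c) →
    randomSubsetProb G p (fun A₂ => Expands (A₀ ∪ A₂) (ε * n) ∧
      ∃ φ : G → F, FreimanHomOn (A₀ ∪ A₂) φ ∧ ¬ AffineOn (A₀ ∪ A₂) φ) ≤
      6 * Real.exp (-(c * n)) := by
  set η := ε / 16 with hη
  have hη0 : 0 < η := by positivity
  obtain ⟨c₁, hc₁, H⟩ := bad_hit (η / 2) (by positivity) (by rw [hη]; linarith)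
  set c₂ := min (c₁ / 2) (4 * η) with hc₂
  have hc₂0 : 0 < c₂ := lt_min (by linarith) (by linarith)
  have hc₂1 : c₂ ≤ 1 := (min_le_right _ _).trans (by rw [hη]; linarith)
  set L := Real.log (4 / c₂) with hLdef
  have h4 : 1 ≤ 4 / c₂ := by rw [le_div_iff₀ hc₂0]; linarith
  have hL : 0 ≤ L := Real.log_nonneg h4
  have heL : Real.exp (-L) = c₂ / 4 := by
    rw [Real.exp_neg, Real.exp_log (by positivity)]; field_simp
  set ε₁ := min (ε / 4096) (c₂ / (64 * (L + 1))) with hε₁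
  have hε₁0 : 0 < ε₁ := lt_min (by linarith) (by positivity)
  have hε₁a : ε₁ ≤ ε / 4096 := min_le_left _ _
  have hε₁b : ε₁ * (64 * (L + 1)) ≤ c₂ := by
    rw [← le_div_iff₀ (by positivity)]; exact min_le_right _ _
  refine ⟨ε₁, c₂ / 2, hε₁0, by linarith, by linarith, ?_⟩
  intro G _ _ p n h0 h1 hpn hnp hn3 hn2 F _ A₀ hA₀ hgood
  set N : ℝ := (Fintype.card G : ℝ) with hN
  have hNpos : 0 < N := by rw [hN]; exact_mod_cast Fintype.card_pos
  have hn0 : 0 ≤ n := le_trans (by positivity) hpn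
  have hn2N : n ≤ 2 * N := by nlinarith
  obtain ⟨Ψ, hΨ⟩ := compress_choice (F := F) A₀ hgood
  -- choose approximating affine maps
  have hZ : ∀ K : Finset G, ∃ (g : G →+ F) (s : F),
      ((badT (Ψ K)).card : ℝ) ≤ η * N ^ 3 →
      ((Finset.univ.filter (fun x => Ψ K x ≠ g x + s)).card : ℝ) ≤ 2 * η * N := by
    intro K
    by_cases h : ((badT (Ψ K)).card : ℝ) ≤ η * N ^ 3
    · obtain ⟨g, s, hgs⟩ := blr (Ψ K) η hη0.le (by rw [hη]; linarith) h
      exact ⟨g, s, fun _ => hgs⟩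
    · exact ⟨0, 0, fun h' => absurd h' h⟩
  choose g s hgs using hZ
  set Z : Finset G → Finset G := fun K => Finset.univ.filter (fun x => Ψ K x ≠ g K x + s K) with hZdef
  set k : ℝ := 16 * (ε₁ * n) with hk
  set S : Finset (Finset G) := Finset.univ.filter (fun K => (K.card : ℝ) ≤ k) with hS
  set Q : Finset G → Finset G → Prop := fun K B =>
    (((badT (Ψ K)).card : ℝ) ≤ η * N ^ 3 ∧ 8 * (η * n) ≤ ((B ∩ Z K).card : ℝ)) ∨
    (η * N ^ 3 < ((badT (Ψ K)).card : ℝ) ∧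
      ¬ ∃ a b c, (a, b, c) ∈ badT (Ψ K) ∧ a ∈ B ∧ b ∈ B ∧ c ∈ B ∧ a + b - c ∈ B) with hQ
  have step1 : randomSubsetProb G p (fun A₂ => Expands (A₀ ∪ A₂) (ε * n) ∧
      ∃ φ : G → F, FreimanHomOn (A₀ ∪ A₂) φ ∧ ¬ AffineOn (A₀ ∪ A₂) φ) ≤
      randomSubsetProb G p (fun A => ∃ K ∈ S, K ⊆ A ∧ Q K (A \ K)) := by
    refine pr_mono h0 h1 ?_
    rintro A₂ ⟨hexp, hφ⟩
    obtain ⟨K, hKA, hKc, hfr, hna⟩ := hΨ A₂ hφ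
    have hKc' : (K.card : ℝ) ≤ 4 * A₀.card := by exact_mod_cast hKc
    refine ⟨K, ?_, hKA, ?_⟩
    · rw [hS, Finset.mem_filter]
      exact ⟨Finset.mem_univ _, by rw [hk]; linarith⟩
    · rcases le_or_gt ((badT (Ψ K)).card : ℝ) (η * N ^ 3) with hcase | hcase
      · refine Or.inl ⟨hcase, ?_⟩
        by_contra hlt
        push Not at hlt
        apply hna
        refine ⟨g K, s K, fun a ha => ?_⟩
        refine expands_affine (A₀ ∪ A₂) (ε * n) hexp (Ψ K) hfr (g K) (s K) ?_ a
          (Finset.mem_union_left _ ha)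
        have hsub : (A₀ ∪ A₂).filter (fun a => Ψ K a ≠ g K a + s K) ⊆
            A₀ ∪ (K ∪ ((A₂ \ K) ∩ Z K)) := by
          intro x hx
          simp only [hZdef, Finset.mem_filter, Finset.mem_union, Finset.mem_inter,
            Finset.mem_sdiff, Finset.mem_univ, true_and] at hx ⊢
          tauto
        have h5 := (Finset.card_le_card hsub).trans ((Finset.card_union_le _ _).trans
          (Nat.add_le_add_left (Finset.card_union_le _ _) _))
        have h6 : (((A₀ ∪ A₂).filter (fun a => Ψ K a ≠ g K a + s K)).card : ℝ) ≤
            A₀.card + (K.card + ((A₂ \ K) ∩ Z K).card) := by exact_mod_cast h5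
        refine h6.trans ?_
        have h7 : ε₁ * n ≤ ε / 4096 * n := by gcongr
        have h8 : 8 * (η * n) = ε * n / 2 := by rw [hη]; ring
        have h9 : 0 ≤ ε * n := by positivity
        linarith
      · refine Or.inr ⟨hcase, ?_⟩
        rintro ⟨a, b, c, hbad, ha, hb, hc, hd⟩
        have hin : ∀ x, x ∈ A₂ \ K → x ∈ A₀ ∪ A₂ := fun x hx =>
          Finset.mem_union_right _ (Finset.sdiff_subset hx)
        have := hfr a (hin a ha) b (hin b hb) _ (hin _ hd) c (hin c hc) (by abel)
        rw [badT, Finset.mem_filter] at hbad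
        apply hbad.2
        simp only
        linear_combination -this
  refine step1.trans ((pr_compress h0 h1 S Q).trans ?_)
  have step2 : ∀ K ∈ S, randomSubsetProb G p (fun A => Q K (A \ K)) ≤
      6 * Real.exp (-(c₂ * n)) := by
    intro K hK
    rw [hS, Finset.mem_filter] at hK
    have hKk := hK.2
    have hexppos := Real.exp_pos (-(c₂ * n))
    rcases le_or_gt ((badT (Ψ K)).card : ℝ) (η * N ^ 3) with hcase | hcase
    · have hm : randomSubsetProb G p (fun A => Q K (A \ K)) ≤
          randomSubsetProb G p (fun A => 8 * (η * n) ≤ ((A ∩ Z K).card : ℝ)) := by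
        refine pr_mono h0 h1 fun A hA => ?_
        rcases hA with hA | hA
        · refine hA.2.trans ?_
          exact_mod_cast Finset.card_le_card (Finset.inter_subset_inter_right Finset.sdiff_subset)
        · linarith [hA.1]
      refine hm.trans ((pr_tail h0 h1 _ _).trans ?_)
      have h5 := hgs K hcase
      have h6 : Real.exp (2 * p * ((Z K).card : ℝ) - 8 * (η * n)) ≤ Real.exp (-(c₂ * n)) := by
        apply Real.exp_le_exp.2
        have h7 : 2 * p * ((Z K).card : ℝ) ≤ 2 * p * (2 * η * N) := by gcongr
        have h8 : 2 * p * (2 * η * N) = 4 * η * (p * N) := by ring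
        have h9 : 4 * η * (p * N) ≤ 4 * η * n := by gcongr
        have h10 : c₂ * n ≤ 4 * η * n := by gcongr; exact min_le_right _ _
        linarith
      linarith
    · set B' := (badT (Ψ K)).filter
        (fun z => z.1 ∉ K ∧ z.2.1 ∉ K ∧ z.2.2 ∉ K ∧ z.1 + z.2.1 - z.2.2 ∉ K) with hB'
      have hm : randomSubsetProb G p (fun A => Q K (A \ K)) ≤
          randomSubsetProb G p (fun A => ¬ ∃ a b c, (a, b, c) ∈ B' ∧ a ∈ A ∧ b ∈ A ∧ c ∈ A ∧
            a + b - c ∈ A) := by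
        refine pr_mono h0 h1 fun A hA => ?_
        rcases hA with hA | hA
        · linarith [hA.1]
        · rintro ⟨a, b, c, hbad, ha, hb, hc, hd⟩
          rw [hB', Finset.mem_filter] at hbad
          obtain ⟨hb0, k1, k2, k3, k4⟩ := hbad
          exact hA.2 ⟨a, b, c, hb0, Finset.mem_sdiff.2 ⟨ha, k1⟩, Finset.mem_sdiff.2 ⟨hb, k2⟩,
            Finset.mem_sdiff.2 ⟨hc, k3⟩, Finset.mem_sdiff.2 ⟨hd, k4⟩⟩
      have hB'c : η / 2 * N ^ 3 ≤ (B'.card : ℝ) := by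
        have h5 := card_avoid (badT (Ψ K)) K
        rw [← hN] at h5
        have h6 : (K.card : ℝ) ≤ η / 8 * N := by
          have h7 : ε₁ * n ≤ ε / 4096 * (2 * N) := by gcongr
          rw [hη]; linarith
        have h8 : 4 * (K.card : ℝ) * N ^ 2 ≤ 4 * (η / 8 * N) * N ^ 2 := by gcongr
        have h9 : 4 * (η / 8 * N) * N ^ 2 = η / 2 * N ^ 3 := by ring
        rw [hB']
        linarith
      refine hm.trans ((H G p h0 h1 hn3 hn2 B' hB'c).trans ?_)
      refine mul_le_mul_of_nonneg_left ?_ (by norm_num)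
      apply Real.exp_le_exp.2
      rw [← hN]
      have h10 : c₂ * n ≤ c₁ / 2 * (2 * (p * N)) := by
        apply mul_le_mul (min_le_left _ _) hnp hn0 (by linarith)
      linarith
  have hsm := sum_small h0 L k hL S (fun K hK => by
      rw [hS, Finset.mem_filter] at hK; exact hK.2)
  calc ∑ K ∈ S, p ^ K.card * randomSubsetProb G p (fun A => Q K (A \ K))
      ≤ ∑ K ∈ S, p ^ K.card * (6 * Real.exp (-(c₂ * n))) :=
        Finset.sum_le_sum fun K hK => mul_le_mul_of_nonneg_left (step2 K hK) (pow_nonneg h0 _)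
    _ = (∑ K ∈ S, p ^ K.card) * (6 * Real.exp (-(c₂ * n))) := by rw [Finset.sum_mul]
    _ ≤ Real.exp (L * k + Real.exp (-L) * (p * N)) * (6 * Real.exp (-(c₂ * n))) := by gcongr
    _ = 6 * Real.exp (L * k + Real.exp (-L) * (p * N) + -(c₂ * n)) := by
        rw [Real.exp_add (_ + _)]; ring
    _ ≤ _ := by
        gcongr
        rw [heL]
        have h5 : (ε₁ * (64 * (L + 1))) * n ≤ c₂ * n := by gcongr
        have h6 : c₂ / 4 * (p * N) ≤ c₂ / 4 * n := by gcongr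
        have h7 : L * k = 16 * (ε₁ * L * n) := by rw [hk]; ring
        have h8 : 0 ≤ ε₁ * n := by positivity
        have h9 : (ε₁ * (64 * (L + 1))) * n = 64 * (ε₁ * L * n) + 64 * (ε₁ * n) := by ring
        linarith

/-- some Freiman homomorphism to a small prime field is not affine -/
def BadEv {G : Type} [AddCommGroup G] [Fintype G] (A : Finset G) : Prop :=
  ∃ q ∈ (range (Fintype.card G + 1)).filter Nat.Prime, ∃ φ : G → ZMod q,
    FreimanHomOn A φ ∧ ¬ ∃ (g : G →+ ZMod q) (s : ZMod q), ∀ a ∈ A, φ a = g a + s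

set_option maxHeartbeats 2000000 in
lemma combo : ∃ κ : ℝ, 0 < κ ∧ ∀ (G : Type) [AddCommGroup G] [Fintype G] (p n : ℝ),
    n = p * Fintype.card G → 0 ≤ p → p ≤ 1 → 1 ≤ κ * n → n * p ≤ 1 →
    Real.exp (-(κ * (n ^ 3 / Fintype.card G))) ≤ 1 / Fintype.card G →
    (Fintype.card G : ℝ) ≤ (n / 8) ^ 3 → (8 : ℝ) ≤ Fintype.card G →
    randomSubsetProb G p BadEv ≤ (Real.exp p - 1) +
      Fintype.card G * Real.exp (-(κ * (n ^ 3 / Fintype.card G))) +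
      (9 * Fintype.card G + 10) * Real.exp (-(κ * n)) := by
  obtain ⟨cE, ε, hcE, hcE1, hε, hε1, hexp⟩ := expand_all
  obtain ⟨ε₁, cM, hε₁, hε₁h, hcM, hmain⟩ := main_round ε hε hε1
  obtain ⟨c₁, hc₁, hc₁1, hone⟩ := expand_one
  refine ⟨min cE (min (c₁ * ε₁ ^ 3) cM), by positivity, ?_⟩
  set κ := min cE (min (c₁ * ε₁ ^ 3) cM) with hκ
  have k1 : κ ≤ cE := min_le_left _ _
  have k2 : κ ≤ c₁ * ε₁ ^ 3 := (min_le_right _ _).trans (min_le_left _ _)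
  have k3 : κ ≤ cM := (min_le_right _ _).trans (min_le_right _ _)
  have hκ0 : 0 < κ := by positivity
  have e3 : ε₁ ^ 3 ≤ ε₁ := by
    have : ε₁ ^ 3 ≤ ε₁ ^ 1 := pow_le_pow_of_le_one hε₁.le (by linarith) (by norm_num)
    simpa using this
  have k4 : κ ≤ c₁ * ε₁ := k2.trans (mul_le_mul_of_nonneg_left e3 hc₁.le)
  have k5 : κ ≤ 2 * ε₁ := by nlinarith
  intro G _ _ p n hn hp0 hp1 h1 h2 h3 h4 h5
  set N : ℝ := (Fintype.card G : ℝ) with hN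
  have hNpos : 0 < N := by linarith
  have hn0 : 0 ≤ n := by rw [hn]; positivity
  have hn3 : 0 ≤ n ^ 3 / N := by positivity
  have hnsq : n ^ 2 ≤ N := by
    have : n ^ 2 = n * p * N := by rw [hn]; ring
    rw [this]; nlinarith
  -- the expansion part
  have hA : randomSubsetProb G p (fun A => ¬ Expands A (ε * n)) ≤
      3 * Real.exp (-(κ * n)) + (Real.exp p - 1) := by
    have := hexp G p hp0 hp1 (by rw [← hN, ← hn]; nlinarith) (by rw [← hN, ← hn]; exact h2)
      (by
        rw [← hN, ← hn]
        refine le_trans (Real.exp_le_exp.2 ?_) h3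
        have := mul_le_mul_of_nonneg_right k1 hn3
        linarith)
    rw [← hN, ← hn] at this
    refine this.trans ?_
    have : Real.exp (-(cE * n)) ≤ Real.exp (-(κ * n)) :=
      Real.exp_le_exp.2 (by have := mul_le_mul_of_nonneg_right k1 hn0; linarith)
    linarith
  -- the main part
  set E : Finset G → Prop := fun A => Expands A (ε * n) ∧ BadEv A with hE
  set Fv : Finset G → Prop := fun A => 4 * (ε₁ * n) ≤ (A.card : ℝ) ∨
    ∃ x ∈ (univ : Finset G), ¬ ∃ a b c, a ∈ A \ {x} ∧ b ∈ A \ {x} ∧ c ∈ A \ {x} ∧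
      a + b - c ∈ ({x} : Finset G) with hFv
  have hp₁0 : 0 ≤ ε₁ * p := by positivity
  have hp₁1 : ε₁ * p ≤ 1 / 2 := by nlinarith
  have hF : randomSubsetProb G (ε₁ * p) Fv ≤ Real.exp (-(κ * n)) +
      N * (3 * Real.exp (-(κ * n)) + Real.exp (-(κ * (n ^ 3 / N)))) := by
    refine (pr_or hp₁0 (by linarith) _ _).trans (add_le_add ?_ ?_)
    · have := pr_size (G := G) hp₁0 (by linarith : ε₁ * p ≤ 1)
      rw [← hN, show ε₁ * p * N = ε₁ * n by rw [hn]; ring] at this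
      refine this.trans (Real.exp_le_exp.2 ?_)
      have := mul_le_mul_of_nonneg_right k5 hn0
      linarith
    · refine (pr_exists hp₁0 (by linarith) _ _).trans ?_
      have hx : ∀ x ∈ (univ : Finset G), randomSubsetProb G (ε₁ * p) (fun A =>
          ¬ ∃ a b c, a ∈ A \ {x} ∧ b ∈ A \ {x} ∧ c ∈ A \ {x} ∧
          a + b - c ∈ ({x} : Finset G)) ≤
          3 * Real.exp (-(κ * n)) + Real.exp (-(κ * (n ^ 3 / N))) := by
        intro x _
        have h := hone G (ε₁ * p) hp₁0 (by linarith) (by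
          rw [← hN, show c₁ * (ε₁ * p * N) = c₁ * ε₁ * n by rw [hn]; ring]
          have := mul_le_mul_of_nonneg_right k4 hn0
          linarith) {x} (by simp) (by simp; linarith) (by rw [Finset.card_singleton, Nat.cast_one, mul_one]; exact h5)
        rw [← hN, show ε₁ * p * N = ε₁ * n by rw [hn]; ring] at h
        refine h.trans (add_le_add ?_ ?_)
        · refine mul_le_mul_of_nonneg_left (Real.exp_le_exp.2 ?_) (by norm_num)
          have := mul_le_mul_of_nonneg_right k4 hn0
          linarith
        · refine Real.exp_le_exp.2 ?_
          have := mul_le_mul_of_nonneg_right k2 hn3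
          have e : c₁ * (((({x} : Finset G).card : ℕ) : ℝ) * (ε₁ * n) ^ 3 / N) =
            c₁ * ε₁ ^ 3 * (n ^ 3 / N) := by simp; ring
          rw [e]; linarith
      refine (Finset.sum_le_sum hx).trans ?_
      rw [Finset.sum_const, nsmul_eq_mul, Finset.card_univ]
  have hB : randomSubsetProb G p E ≤ (Real.exp (-(κ * n)) +
      N * (3 * Real.exp (-(κ * n)) + Real.exp (-(κ * (n ^ 3 / N))))) +
      (N + 1) * (6 * Real.exp (-(κ * n))) := by
    refine pr_round hp₁0 (by nlinarith) hp1 (by linarith) E Fv hF (by positivity) ?_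
    intro p' hp' hp'0 hp'p A₀ hA₀
    obtain ⟨hs, hg⟩ := not_or.1 hA₀
    rw [not_le] at hs
    have hhalf : p / 2 ≤ p' := by nlinarith
    have hp'1 : p' ≤ 1 := hp'p.trans hp1
    have hg' : ∀ x : G, ∃ a ∈ A₀, ∃ b ∈ A₀, ∃ c ∈ A₀, x = a + b - c := by
      intro x
      obtain ⟨a, b, c, ha, hb, hc, h⟩ := Classical.byContradiction
        (fun hh => hg ⟨x, Finset.mem_univ x, hh⟩)
      rw [Finset.mem_sdiff] at ha hb hc
      exact ⟨a, ha.1, b, hb.1, c, hc.1, (Finset.mem_singleton.1 h).symm⟩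
    have q1 : p' * N ≤ n := by rw [hn]; nlinarith
    have q2 : n ≤ 2 * (p' * N) := by rw [hn]; nlinarith
    have q3 : n / 8 ≤ p' / 4 * N := by linarith
    have q4 : N ≤ (p' / 4 * N) ^ 3 :=
      h4.trans (pow_le_pow_left₀ (by positivity) q3 3)
    have q5 : (p' / 4 * N) ^ 2 ≤ 8 * N := by
      have : (p' / 4 * N) ^ 2 ≤ n ^ 2 :=
        pow_le_pow_left₀ (by positivity) (by nlinarith [mul_nonneg hp'0 hNpos.le]) 2
      linarith
    refine (pr_mono hp'0 hp'1 (F := fun A₂ => ∃ q ∈ (range (Fintype.card G + 1)).filter Nat.Prime,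
      (Expands (A₀ ∪ A₂) (ε * n) ∧ ∃ φ : G → ZMod q,
        FreimanHomOn (A₀ ∪ A₂) φ ∧ ¬ ∃ (g : G →+ ZMod q) (s : ZMod q),
          ∀ a ∈ A₀ ∪ A₂, φ a = g a + s)) ?_).trans ?_
    · rintro A ⟨hA1, q, hq, hφ⟩
      exact ⟨q, hq, hA1, hφ⟩
    refine (pr_exists hp'0 hp'1 _ _).trans ?_
    have hq : ∀ q ∈ (range (Fintype.card G + 1)).filter Nat.Prime,
        randomSubsetProb G p' (fun A₂ => (Expands (A₀ ∪ A₂) (ε * n) ∧ ∃ φ : G → ZMod q,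
        FreimanHomOn (A₀ ∪ A₂) φ ∧ ¬ ∃ (g : G →+ ZMod q) (s : ZMod q),
          ∀ a ∈ A₀ ∪ A₂, φ a = g a + s)) ≤ 6 * Real.exp (-(κ * n)) := by
      intro q hq
      haveI : Fact q.Prime := ⟨(Finset.mem_filter.1 hq).2⟩
      have h := hmain G p' n hp'0 hp'1 q1 q2 q4 q5 (ZMod q) A₀ hs.le hg'
      refine le_trans (le_trans (le_of_eq ?_) h) ?_
      · rfl
      · refine mul_le_mul_of_nonneg_left (Real.exp_le_exp.2 ?_) (by norm_num)
        have := mul_le_mul_of_nonneg_right k3 hn0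
        linarith
    refine (Finset.sum_le_sum hq).trans ?_
    rw [Finset.sum_const, nsmul_eq_mul]
    refine mul_le_mul_of_nonneg_right ?_ (by positivity)
    have : ((range (Fintype.card G + 1)).filter Nat.Prime).card ≤ Fintype.card G + 1 := by
      simpa using Finset.card_filter_le (range (Fintype.card G + 1)) Nat.Prime
    rw [hN]
    exact_mod_cast this
  have hfin : randomSubsetProb G p BadEv ≤
      randomSubsetProb G p (fun A => ¬ Expands A (ε * n)) + randomSubsetProb G p E := by
    refine le_trans (pr_mono hp0 hp1 ?_) (pr_or hp0 hp1 _ _)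
    intro A hA
    by_cases h : Expands A (ε * n)
    · exact Or.inr ⟨h, hA⟩
    · exact Or.inl h
  linarith

open Filter Topology in
lemma tend_p (C : ℝ) : Tendsto (fun N : ℕ =>
    C * Real.log N ^ ((1 : ℝ) / 3) * (N : ℝ) ^ (-(2 : ℝ) / 3)) atTop (𝓝 0) := by
  have h := (isLittleO_log_rpow_rpow_atTop (1/3 : ℝ) (by norm_num : (0:ℝ) < 2/3)).tendsto_div_nhds_zero
  have h2 := (h.comp tendsto_natCast_atTop_atTop).const_mul C
  rw [mul_zero] at h2
  refine h2.congr' ?_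
  filter_upwards [eventually_gt_atTop 0] with N hN
  have hN' : (0:ℝ) < N := by exact_mod_cast hN
  simp only [Function.comp]
  rw [show (-(2:ℝ)/3) = -(2/3) by norm_num, Real.rpow_neg hN'.le]
  ring

open Filter Topology in
lemma tend_np (C : ℝ) : Tendsto (fun N : ℕ =>
    (C * Real.log N ^ ((1 : ℝ) / 3) * (N : ℝ) ^ (-(2 : ℝ) / 3)) * N *
    (C * Real.log N ^ ((1 : ℝ) / 3) * (N : ℝ) ^ (-(2 : ℝ) / 3))) atTop (𝓝 0) := by
  have h := (isLittleO_log_rpow_rpow_atTop (2/3 : ℝ) (by norm_num : (0:ℝ) < 1/3)).tendsto_div_nhds_zero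
  have h2 := (h.comp tendsto_natCast_atTop_atTop).const_mul (C ^ 2)
  rw [mul_zero] at h2
  refine h2.congr' ?_
  filter_upwards [eventually_gt_atTop 1] with N hN
  have hN' : (0:ℝ) < N := by exact_mod_cast (by omega : 0 < N)
  have hl : 0 < Real.log N := Real.log_pos (by exact_mod_cast hN)
  simp only [Function.comp]
  have e1 : Real.log N ^ ((2:ℝ)/3) = Real.log N ^ ((1:ℝ)/3) * Real.log N ^ ((1:ℝ)/3) := by
    rw [← Real.rpow_add hl]; norm_num
  have e2 : ((N:ℝ) ^ ((1:ℝ)/3))⁻¹ = (N:ℝ) ^ (-(2:ℝ)/3) * N * (N:ℝ) ^ (-(2:ℝ)/3) := by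
    rw [← Real.rpow_neg hN'.le]
    nth_rewrite 3 [← Real.rpow_one (N:ℝ)]
    rw [← Real.rpow_add hN', ← Real.rpow_add hN']; norm_num
  rw [div_eq_mul_inv, e1, e2]
  ring

lemma n_cube (C : ℝ) (N : ℕ) (hN : 1 < N) :
    ((C * Real.log N ^ ((1 : ℝ) / 3) * (N : ℝ) ^ (-(2 : ℝ) / 3)) * N) ^ 3 =
      C ^ 3 * Real.log N * N := by
  have hN' : (0:ℝ) < N := by exact_mod_cast (by omega : 0 < N)
  have hl : 0 < Real.log N := Real.log_pos (by exact_mod_cast hN)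
  have e1 : (Real.log N ^ ((1 : ℝ) / 3)) ^ 3 = Real.log N := by
    rw [← Real.rpow_natCast, ← Real.rpow_mul hl.le]; norm_num
  have e2 : ((N : ℝ) ^ (-(2 : ℝ) / 3)) ^ 3 * N ^ 3 = N := by
    rw [← Real.rpow_natCast, ← Real.rpow_mul hN'.le]
    have : ((-(2:ℝ)/3) * ((3:ℕ):ℝ)) = ((-2 : ℤ) : ℝ) := by norm_num
    rw [this, Real.rpow_intCast]
    field_simp
  calc _ = C ^ 3 * (Real.log N ^ ((1 : ℝ) / 3)) ^ 3 *
        (((N : ℝ) ^ (-(2 : ℝ) / 3)) ^ 3 * N ^ 3) := by ring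
    _ = _ := by rw [e1, e2]

open Filter Topology in
theorem freiman_main_aux :
    ∃ C : ℝ, 0 < C ∧ ∀ δ : ℝ, 0 < δ → ∃ N₀ : ℕ, ∀ (N : ℕ) [NeZero N], N₀ ≤ N →
      1 - δ ≤ randomSubsetProb (ZMod N)
          (C * Real.log N ^ ((1 : ℝ) / 3) * (N : ℝ) ^ (-(2 : ℝ) / 3))
          (fun A => ∀ φ : ZMod N → ZMod N, FreimanHomOn A φ →
            ∃ r s : ZMod N, ∀ a ∈ A, φ a = r * a + s) := by
  obtain ⟨κ, hκ, hcombo⟩ := combo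
  set C : ℝ := 1 + 2 / κ with hC
  have hC1 : 1 ≤ C := by rw [hC]; have : 0 < 2 / κ := by positivity
                         linarith
  have hC0 : 0 < C := by linarith
  have hC3 : 2 ≤ κ * C ^ 3 := by
    have : C ≤ C ^ 3 := by
      have := pow_le_pow_right₀ hC1 (show 1 ≤ 3 by norm_num)
      simpa using this
    have h2 : κ * C = κ + 2 := by rw [hC]; field_simp
    nlinarith
  refine ⟨C, hC0, ?_⟩
  intro δ hδ
  set P : ℕ → ℝ := fun N => C * Real.log N ^ ((1 : ℝ) / 3) * (N : ℝ) ^ (-(2 : ℝ) / 3) with hP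
  have t1 : Tendsto P atTop (𝓝 0) := tend_p C
  have t2 : Tendsto (fun N => P N * N * P N) atTop (𝓝 0) := tend_np C
  have t3 : Tendsto (fun N => Real.exp (P N) - 1) atTop (𝓝 0) := by
    have := ((Real.continuous_exp.tendsto 0).comp t1).sub_const 1
    simpa using this
  have t4 : Tendsto (fun N : ℕ => (1:ℝ) / N) atTop (𝓝 0) := tendsto_one_div_atTop_nhds_zero_nat
  have t5 : Tendsto (fun N : ℕ => Real.log N) atTop atTop :=
    Real.tendsto_log_atTop.comp tendsto_natCast_atTop_atTop
  have t6 : Tendsto (fun N : ℕ => (N : ℝ) ^ ((1:ℝ)/3)) atTop atTop :=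
    (tendsto_rpow_atTop (by norm_num)).comp tendsto_natCast_atTop_atTop
  have t7 : Tendsto (fun N : ℕ => 19 * (((N : ℝ) ^ ((1:ℝ)/3)) ^ 3 *
      Real.exp (-(κ * (N : ℝ) ^ ((1:ℝ)/3))))) atTop (𝓝 0) := by
    have h := Real.tendsto_pow_mul_exp_neg_atTop_nhds_zero 3
    have h2 := (h.comp (t6.const_mul_atTop hκ)).const_mul (19 / κ ^ 3)
    rw [mul_zero] at h2
    refine h2.congr ?_
    intro N
    simp only [Function.comp]
    field_simp
  have ht := (t3.add t4).add t7
  rw [add_zero, add_zero] at ht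
  have hev : ∀ᶠ N : ℕ in atTop, 8 ≤ N ∧ P N ≤ 1 ∧ P N * N * P N ≤ 1 ∧ 512 ≤ Real.log N ∧
      1 / κ ≤ (N : ℝ) ^ ((1:ℝ)/3) ∧ Real.exp (P N) - 1 + 1 / N + 19 * (((N : ℝ) ^ ((1:ℝ)/3)) ^ 3 *
      Real.exp (-(κ * (N : ℝ) ^ ((1:ℝ)/3)))) ≤ δ := by
    filter_upwards [eventually_ge_atTop 8, t1.eventually_le_const one_pos,
      t2.eventually_le_const one_pos, t5.eventually_ge_atTop 512, t6.eventually_ge_atTop (1 / κ),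
      ht.eventually_le_const hδ] with N a b c d e f
    exact ⟨a, b, c, d, e, f⟩
  obtain ⟨N₀, hN₀⟩ := eventually_atTop.1 hev
  refine ⟨N₀, ?_⟩
  intro N _ hN
  obtain ⟨a1, a2, a3, a4, a5, a6⟩ := hN₀ N hN
  have a1' : (8:ℝ) ≤ N := by exact_mod_cast a1
  have hNpos : (0:ℝ) < N := by linarith
  have hcube : (P N * N) ^ 3 = C ^ 3 * Real.log N * N := n_cube C N (by omega)
  have hP0 : 0 ≤ P N := by
    have : 0 ≤ Real.log N := by linarith
    simp only [hP]; positivity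
  have hC31 : 1 ≤ C ^ 3 := one_le_pow₀ hC1
  have hm3 : ((N : ℝ) ^ ((1:ℝ)/3)) ^ 3 = N := by
    rw [← Real.rpow_natCast, ← Real.rpow_mul hNpos.le]; norm_num
  have hge : (N : ℝ) ^ ((1:ℝ)/3) ≤ P N * N := by
    refine le_of_pow_le_pow_left₀ (n := 3) (by norm_num) (by positivity) ?_
    rw [hcube, hm3]
    have : 1 ≤ C ^ 3 * Real.log N := by nlinarith
    nlinarith
  have hlog : Real.exp (-(κ * ((P N * N) ^ 3 / N))) ≤ 1 / (N : ℝ) ^ 2 := by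
    have e : (P N * N) ^ 3 / N = C ^ 3 * Real.log N := by rw [hcube]; field_simp
    rw [e]
    have : (1 / (N : ℝ) ^ 2) = Real.exp (-(2 * Real.log N)) := by
      rw [Real.exp_neg, two_mul, Real.exp_add, Real.exp_log hNpos]
      field_simp
    rw [this]
    refine Real.exp_le_exp.2 ?_
    have : 2 * Real.log N ≤ κ * C ^ 3 * Real.log N :=
      mul_le_mul_of_nonneg_right hC3 (by linarith)
    linarith
  have hsq : 1 / (N : ℝ) ^ 2 ≤ 1 / N := by
    refine one_div_le_one_div_of_le hNpos ?_
    nlinarith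
  have hmain := hcombo (ZMod N) (P N) (P N * N) (by rw [ZMod.card]) hP0 a2
    (by
      have : 1 ≤ κ * (N : ℝ) ^ ((1:ℝ)/3) := by
        rw [div_le_iff₀ hκ] at a5; linarith
      nlinarith)
    a3 (by rw [ZMod.card]; exact hlog.trans hsq)
    (by
      rw [ZMod.card, div_pow, hcube, le_div_iff₀ (by norm_num)]
      have : 512 ≤ C ^ 3 * Real.log N := by nlinarith
      nlinarith) (by rw [ZMod.card]; exact a1')
  rw [ZMod.card] at hmain
  rw [pr_compl]
  have hb : randomSubsetProb (ZMod N) (P N) (fun A => ¬ ∀ φ : ZMod N → ZMod N, FreimanHomOn A φ →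
            ∃ r s : ZMod N, ∀ a ∈ A, φ a = r * a + s) ≤ randomSubsetProb (ZMod N) (P N) BadEv := by
    refine pr_mono hP0 a2 ?_
    intro A hA
    by_contra hbad
    refine hA (lift_final N A ?_)
    intro q hq hqN φ hφ
    by_contra hno
    refine hbad ⟨q, ?_, φ, hφ, hno⟩
    rw [Finset.mem_filter, Finset.mem_range, ZMod.card]
    exact ⟨Nat.lt_succ_of_le (Nat.le_of_dvd (by omega) hqN), hq⟩
  have b1 : (N : ℝ) * Real.exp (-(κ * ((P N * N) ^ 3 / N))) ≤ 1 / N := by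
    refine (mul_le_mul_of_nonneg_left hlog hNpos.le).trans (le_of_eq ?_)
    field_simp
  have b2 : (9 * (N : ℝ) + 10) * Real.exp (-(κ * (P N * N))) ≤
      19 * (((N : ℝ) ^ ((1:ℝ)/3)) ^ 3 * Real.exp (-(κ * (N : ℝ) ^ ((1:ℝ)/3)))) := by
    rw [hm3, ← mul_assoc (19 : ℝ) (N : ℝ)]
    refine mul_le_mul (by linarith) (Real.exp_le_exp.2 ?_) (Real.exp_pos _).le (by positivity)
    have := mul_le_mul_of_nonneg_left hge hκ.le
    linarith
  change 1 - δ ≤ 1 - randomSubsetProb (ZMod N) (P N) _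
  linarith

theorem freiman_hom_affine_random_ZMod :
    ∃ C : ℝ, 0 < C ∧ ∀ δ : ℝ, 0 < δ → ∃ N₀ : ℕ, ∀ (N : ℕ) [NeZero N], N₀ ≤ N →
      1 - δ ≤ randomSubsetProb (ZMod N)
          (C * Real.log N ^ ((1 : ℝ) / 3) * (N : ℝ) ^ (-(2 : ℝ) / 3))
          (fun A => ∀ φ : ZMod N → ZMod N, FreimanHomOn A φ →
            ∃ r s : ZMod N, ∀ a ∈ A, φ a = r * a + s) := by
  exact freiman_main_aux

end
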